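/- Let S be a cap in F = (Fin 6 → ZMod 3) and let ℓ : F → ZMod 3 be a nonzero linear functional such that the slices S ∩ ℓ⁻¹(1) and S ∩ ℓ⁻¹(2) each have exactly 45 points. If there exists u ∈ F with ℓ(u) = 1 such that S ∩ ℓ⁻¹(2) = { x + u : x ∈ S ∩ ℓ⁻¹(1) } (the two 45-point slices are translations of each other), then the slice S ∩ ℓ⁻¹(0) is empty. -/

import Mathlib

/-- A cap in the `n`-dimensional affine space over the field of three elements. -/
def IsCap {n : ℕ} (S : Finset (Fin n → ZMod 3)) : Prop :=
  ∀ a ∈ S, ∀ b ∈ S, ∀ c ∈ S, a ≠ b → a ≠ c → b ≠ c → a + b + c ≠ 0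

/-- Three pairwise distinct elements of the set never sum to zero. -/
def IsSumFreeCap {G : Type*} [AddCommGroup G] (S : Finset G) : Prop :=
  ∀ a ∈ S, ∀ b ∈ S, ∀ c ∈ S, a ≠ b → a ≠ c → b ≠ c → a + b + c ≠ 0

theorem add_add_self_eq_zero {V : Type*} [AddCommGroup V] [Module (ZMod 3) V] (v : V) :
    v + v + v = 0 := by
  have h : (1 + 1 + 1 : ZMod 3) • v = 0 := by
    rw [show (1 + 1 + 1 : ZMod 3) = 0 from by decide, zero_smul]
  rwa [add_smul, add_smul, one_smul] at h

section Moments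

theorem card_filter_add_one_eq {M : Type*} [AddCommGroup M] [DecidableEq M] (H : Finset M)
    (φ : M →+ ZMod 3) {f : M} (hf : φ f = 1) (hH : ∀ m ∈ H, m + f ∈ H) (i : ZMod 3) :
    (H.filter fun m => φ m = i).card ≤ (H.filter fun m => φ m = i + 1).card := by
  refine Finset.card_le_card_of_injOn (· + f) ?_ (fun a _ b _ h => add_right_cancel h)
  intro m hm
  simp only [Finset.coe_filter, Set.mem_ofPred_eq] at hm ⊢
  exact ⟨hH m hm.1, by rw [map_add, hm.2, hf]⟩

theorem three_mul_card_filter_eq_zero {M : Type*} [AddCommGroup M] [DecidableEq M] (H : Finset M)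
    (φ : M →+ ZMod 3) {f : M} (hf : φ f = 1) (hH : ∀ m ∈ H, m + f ∈ H) :
    3 * (H.filter fun m => φ m = 0).card = H.card := by
  have h0 := card_filter_add_one_eq H φ hf hH 0
  have h1 := card_filter_add_one_eq H φ hf hH 1
  have h2 := card_filter_add_one_eq H φ hf hH 2
  have e1 : (0 + 1 : ZMod 3) = 1 := by decide
  have e2 : (1 + 1 : ZMod 3) = 2 := by decide
  have e3 : (2 + 1 : ZMod 3) = 0 := by decide
  rw [e1] at h0
  rw [e2] at h1
  rw [e3] at h2
  have hs : H.card = ∑ i : ZMod 3, (H.filter fun m => φ m = i).card :=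
    Finset.card_eq_sum_card_fiberwise (fun _ _ => Finset.mem_coe.2 (Finset.mem_univ _))
  have hs' : ∑ i : ZMod 3, (H.filter fun m => φ m = i).card =
      (H.filter fun m => φ m = 0).card + (H.filter fun m => φ m = 1).card +
        (H.filter fun m => φ m = 2).card := Fin.sum_univ_three _
  omega

variable {V : Type*} [AddCommGroup V] [Module (ZMod 3) V]

theorem exists_dual_eq_one_of_notMem {W : Submodule (ZMod 3) V} {v : V} (hv : v ∉ W) :
    ∃ f : Module.Dual (ZMod 3) V, f v = 1 ∧ ∀ w ∈ W, f w = 0 := by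
  obtain ⟨f, hf, hW⟩ := Submodule.exists_le_ker_of_notMem hv
  refine ⟨(f v)⁻¹ • f, ?_, fun w hw => ?_⟩
  · simp [inv_mul_cancel₀ hf]
  · simp [LinearMap.mem_ker.1 (hW hw)]

/-- The number of points of `S` at which the functional `ℓ` takes the value `i`. -/
def fiberCard (S : Finset V) (ℓ : Module.Dual (ZMod 3) V) (i : ZMod 3) : ℤ :=
  (S.filter fun x => ℓ x = i).card

theorem sum_fiberCard (S : Finset V) (ℓ : Module.Dual (ZMod 3) V) :
    ∑ i, fiberCard S ℓ i = S.card := by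
  unfold fiberCard
  exact_mod_cast (Finset.card_eq_sum_card_fiberwise
    (fun _ _ => Finset.mem_coe.2 (Finset.mem_univ _))).symm

theorem sum_fiberCard_sq (S : Finset V) (ℓ : Module.Dual (ZMod 3) V) :
    ∑ i, fiberCard S ℓ i ^ 2 = ∑ x ∈ S, ∑ y ∈ S, if ℓ (y - x) = 0 then 1 else 0 := by
  simp only [fiberCard, Finset.card_filter, Nat.cast_sum, Nat.cast_ite, Nat.cast_one,
    Nat.cast_zero, sq, Finset.sum_mul_sum]
  rw [Finset.sum_comm]
  refine Finset.sum_congr rfl fun x _ => ?_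
  rw [Finset.sum_comm]
  refine Finset.sum_congr rfl fun y _ => ?_
  simp [map_sub, sub_eq_zero, @eq_comm _ (ℓ x) (ℓ y)]

theorem sum_fiberCard_cube (S : Finset V) (ℓ : Module.Dual (ZMod 3) V) :
    ∑ i, fiberCard S ℓ i ^ 3 =
      ∑ x ∈ S, ∑ y ∈ S, ∑ z ∈ S, if ℓ (y - x) = 0 ∧ ℓ (z - x) = 0 then 1 else 0 := by
  simp only [fiberCard, Finset.card_filter, Nat.cast_sum, Nat.cast_ite, Nat.cast_one,
    Nat.cast_zero, pow_succ, pow_zero, one_mul, Finset.sum_mul_sum]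
  simp only [Finset.sum_mul]
  rw [Finset.sum_comm]
  refine Finset.sum_congr rfl fun x _ => ?_
  rw [Finset.sum_comm]
  refine Finset.sum_congr rfl fun y _ => ?_
  rw [Finset.sum_comm]
  refine Finset.sum_congr rfl fun z _ => ?_
  simp only [map_sub, sub_eq_zero, @eq_comm _ (ℓ y) (ℓ x), @eq_comm _ (ℓ z) (ℓ x)]
  by_cases h : ℓ x = ℓ y <;> by_cases h' : ℓ x = ℓ z <;>
    simp_all [eq_comm]

variable [Fintype (Module.Dual (ZMod 3) V)]

theorem three_mul_card_dual_eq_zero {v : V} (hv : v ≠ 0) :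
    3 * (Finset.univ.filter fun ℓ : Module.Dual (ZMod 3) V => ℓ v = 0).card =
      Fintype.card (Module.Dual (ZMod 3) V) := by
  classical
  obtain ⟨f, hf, -⟩ := exists_dual_eq_one_of_notMem (W := ⊥) (v := v) (by simpa using hv)
  exact three_mul_card_filter_eq_zero Finset.univ
    (Module.Dual.eval (ZMod 3) V v).toAddMonoidHom hf (fun _ _ => Finset.mem_univ _)

theorem nine_mul_card_dual_eq_zero {v w : V} (hv : v ≠ 0)
    (hw : w ∉ Submodule.span (ZMod 3) {v}) :
    9 * (Finset.univ.filter fun ℓ : Module.Dual (ZMod 3) V => ℓ v = 0 ∧ ℓ w = 0).card =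
      Fintype.card (Module.Dual (ZMod 3) V) := by
  classical
  obtain ⟨f, hf, hf0⟩ := exists_dual_eq_one_of_notMem hw
  have h := three_mul_card_filter_eq_zero
    (Finset.univ.filter fun ℓ : Module.Dual (ZMod 3) V => ℓ v = 0)
    (Module.Dual.eval (ZMod 3) V w).toAddMonoidHom (f := f) hf (by
      intro m hm
      simp only [Finset.mem_filter, Finset.mem_univ, true_and] at hm ⊢
      rw [LinearMap.add_apply, hm, hf0 v (Submodule.mem_span_singleton_self v), add_zero])
  rw [Finset.filter_filter] at h
  have h' := three_mul_card_dual_eq_zero hv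
  rw [← h', ← h, show 9 = 3 * 3 from rfl, mul_assoc]
  congr!

theorem three_mul_sum_sum_fiberCard_sq (S : Finset V) :
    3 * ∑ ℓ : Module.Dual (ZMod 3) V, ∑ i, fiberCard S ℓ i ^ 2 =
      Fintype.card (Module.Dual (ZMod 3) V) * ((S.card : ℤ) ^ 2 + 2 * S.card) := by
  classical
  set D := Fintype.card (Module.Dual (ZMod 3) V) with hD
  simp only [sum_fiberCard_sq]
  rw [Finset.sum_comm, Finset.mul_sum]
  have key : ∀ x ∈ S, 3 * ∑ ℓ : Module.Dual (ZMod 3) V,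
      ∑ y ∈ S, (if ℓ (y - x) = 0 then (1 : ℤ) else 0) =
        ∑ y ∈ S, (D : ℤ) * (1 + 2 * if y = x then 1 else 0) := by
    intro x _
    rw [Finset.sum_comm, Finset.mul_sum]
    refine Finset.sum_congr rfl fun y _ => ?_
    rw [Finset.sum_boole]
    by_cases h : y = x
    · subst h
      simp [Finset.filter_true_of_mem, ← hD]
      ring
    · rw [if_neg h]
      have := three_mul_card_dual_eq_zero (sub_ne_zero.2 h)
      simp only [mul_zero, add_zero, mul_one]
      exact_mod_cast this
  rw [Finset.sum_congr rfl key]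
  simp only [← Finset.mul_sum, Finset.sum_add_distrib, Finset.sum_const, nsmul_eq_mul, mul_one]
  congr 1
  have : ∀ x ∈ S, (∑ y ∈ S, if y = x then (1 : ℤ) else 0) = 1 := by
    intro x hx
    simp [hx]
  rw [Finset.sum_congr rfl this]
  simp
  ring

theorem nine_mul_sum_sum_fiberCard_cube {S : Finset V} (hS : IsSumFreeCap S) :
    9 * ∑ ℓ : Module.Dual (ZMod 3) V, ∑ i, fiberCard S ℓ i ^ 3 =
      Fintype.card (Module.Dual (ZMod 3) V) *
        ((S.card : ℤ) ^ 3 + 6 * (S.card : ℤ) ^ 2 + 2 * S.card) := by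
  classical
  set D := Fintype.card (Module.Dual (ZMod 3) V) with hD
  let δ : V → V → ℤ := fun x y => if x = y then 1 else 0
  simp only [sum_fiberCard_cube]
  have key : ∀ x ∈ S, ∀ y ∈ S, ∀ z ∈ S,
      9 * ∑ ℓ : Module.Dual (ZMod 3) V,
        (if ℓ (y - x) = 0 ∧ ℓ (z - x) = 0 then (1 : ℤ) else 0) =
        (D : ℤ) * (1 + 2 * δ y x + 2 * δ z x + 2 * δ z y + 2 * (δ y x * δ z x)) := by
    intro x hx y hy z hz
    rw [Finset.sum_boole]
    by_cases hxy : y = x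
    · subst hxy
      by_cases hzy : z = y
      · subst hzy
        simp [δ, Finset.filter_true_of_mem, ← hD]
        ring
      · have := three_mul_card_dual_eq_zero (sub_ne_zero.2 hzy)
        simp only [sub_self, map_zero, true_and, δ, if_true, hzy, if_false]
        zify at this
        linear_combination 3 * this
    · by_cases hzx : z = x
      · subst hzx
        have := three_mul_card_dual_eq_zero (sub_ne_zero.2 hxy)
        simp only [sub_self, map_zero, and_true, δ, if_true, hxy, Ne.symm hxy, if_false]
        zify at this
        linear_combination 3 * this
      · by_cases hzy : z = y
        · subst hzy
          have := three_mul_card_dual_eq_zero (sub_ne_zero.2 hxy)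
          simp only [and_self, δ, if_true, hxy, if_false]
          zify at this
          linear_combination 3 * this
        · have hspan : z - x ∉ Submodule.span (ZMod 3) {y - x} := by
            rw [Submodule.mem_span_singleton]
            rintro ⟨c, hc⟩
            have hc3 : c = 0 ∨ c = 1 ∨ c = -1 := by clear hc; revert c; decide
            rcases hc3 with rfl | rfl | rfl
            · rw [zero_smul] at hc
              exact hzx (sub_eq_zero.1 hc.symm)
            · rw [one_smul] at hc
              exact hzy (sub_left_injective hc).symm
            · refine hS x hx y hy z hz (Ne.symm hxy) (Ne.symm hzx) (Ne.symm hzy) ?_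
              rw [neg_smul, one_smul, neg_sub] at hc
              have := add_add_self_eq_zero x
              have hz' : z = x - y + x := by rw [hc]; abel
              rw [hz', ← this]
              abel
          have := nine_mul_card_dual_eq_zero (sub_ne_zero.2 hxy) hspan
          simp only [δ, hxy, hzx, hzy, if_false]
          zify at this
          linear_combination this
  have hsum : ∑ ℓ : Module.Dual (ZMod 3) V, ∑ x ∈ S, ∑ y ∈ S, ∑ z ∈ S,
      (if ℓ (y - x) = 0 ∧ ℓ (z - x) = 0 then (1 : ℤ) else 0) =
      ∑ x ∈ S, ∑ y ∈ S, ∑ z ∈ S, ∑ ℓ : Module.Dual (ZMod 3) V,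
        (if ℓ (y - x) = 0 ∧ ℓ (z - x) = 0 then (1 : ℤ) else 0) := by
    rw [Finset.sum_comm]
    refine Finset.sum_congr rfl fun x _ => ?_
    rw [Finset.sum_comm]
    refine Finset.sum_congr rfl fun y _ => ?_
    rw [Finset.sum_comm]
  rw [hsum]
  have hδ : ∀ x ∈ S, ∑ y ∈ S, δ y x = 1 := fun x hx => by simp [δ, hx]
  calc
    _ = ∑ x ∈ S, ∑ y ∈ S, ∑ z ∈ S, 9 * ∑ ℓ : Module.Dual (ZMod 3) V,
        (if ℓ (y - x) = 0 ∧ ℓ (z - x) = 0 then (1 : ℤ) else 0) := by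
      simp only [Finset.mul_sum (a := (9 : ℤ))]
    _ = ∑ x ∈ S, ∑ y ∈ S, ∑ z ∈ S,
        (D : ℤ) * (1 + 2 * δ y x + 2 * δ z x + 2 * δ z y + 2 * (δ y x * δ z x)) :=
      Finset.sum_congr rfl fun x hx => Finset.sum_congr rfl fun y hy =>
        Finset.sum_congr rfl fun z hz => by
          rw [← key x hx y hy z hz]
    _ = ∑ x ∈ S, ∑ y ∈ S, (D : ℤ) * (S.card + 4 + (2 * S.card + 2) * δ y x) :=
      Finset.sum_congr rfl fun x hx => Finset.sum_congr rfl fun y hy => by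
        rw [← Finset.mul_sum]
        simp only [Finset.sum_add_distrib, ← Finset.mul_sum, hδ x hx, hδ y hy,
          Finset.sum_const, nsmul_eq_mul]
        ring
    _ = ∑ x ∈ S, (D : ℤ) * ((S.card : ℤ) ^ 2 + 6 * S.card + 2) :=
      Finset.sum_congr rfl fun x hx => by
        rw [← Finset.mul_sum]
        simp only [Finset.sum_add_distrib, ← Finset.mul_sum, hδ x hx,
          Finset.sum_const, nsmul_eq_mul]
        ring
    _ = _ := by
      rw [Finset.sum_const, nsmul_eq_mul]
      ring

/-- A weighted average over all functionals produces a functional with unbalanced fibres. -/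
theorem exists_dual_fiberCard_lt {S : Finset V} (hS : IsSumFreeCap S) (s t : ℤ)
    (h : s * (S.card * (Fintype.card (Module.Dual (ZMod 3) V) - (S.card : ℤ) ^ 2)) +
      t * (S.card * (Fintype.card (Module.Dual (ZMod 3) V) - (S.card : ℤ))) < 0) :
    ∃ ℓ : Module.Dual (ZMod 3) V, ℓ ≠ 0 ∧
      s * ((3 * fiberCard S ℓ 0 - S.card) * (3 * fiberCard S ℓ 1 - S.card) *
        (3 * fiberCard S ℓ 2 - S.card)) +
      t * (3 * (fiberCard S ℓ 0 ^ 2 + fiberCard S ℓ 1 ^ 2 + fiberCard S ℓ 2 ^ 2) -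
        (S.card : ℤ) ^ 2) < 0 := by
  classical
  set D := Fintype.card (Module.Dual (ZMod 3) V) with hD
  set N : ℤ := (S.card : ℤ) with hN
  let g : Module.Dual (ZMod 3) V → ℤ := fun ℓ =>
    s * ((3 * fiberCard S ℓ 0 - N) * (3 * fiberCard S ℓ 1 - N) * (3 * fiberCard S ℓ 2 - N)) +
      t * (3 * (fiberCard S ℓ 0 ^ 2 + fiberCard S ℓ 1 ^ 2 + fiberCard S ℓ 2 ^ 2) - N ^ 2)
  have hg : ∀ ℓ, g ℓ = 9 * s * ∑ i, fiberCard S ℓ i ^ 3 +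
      (3 * t - 9 * s * N) * ∑ i, fiberCard S ℓ i ^ 2 + (2 * s * N ^ 3 - t * N ^ 2) := by
    intro ℓ
    have h0 : fiberCard S ℓ 0 + fiberCard S ℓ 1 + fiberCard S ℓ 2 = N := by
      rw [hN, ← sum_fiberCard S ℓ]
      exact (Fin.sum_univ_three _).symm
    have h2 : ∑ i, fiberCard S ℓ i ^ 2 =
        fiberCard S ℓ 0 ^ 2 + fiberCard S ℓ 1 ^ 2 + fiberCard S ℓ 2 ^ 2 := Fin.sum_univ_three _
    have h3 : ∑ i, fiberCard S ℓ i ^ 3 =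
        fiberCard S ℓ 0 ^ 3 + fiberCard S ℓ 1 ^ 3 + fiberCard S ℓ 2 ^ 3 := Fin.sum_univ_three _
    rw [h2, h3, ← h0]
    simp only [g]
    rw [← h0]
    ring
  have hsum : ∑ ℓ, g ℓ = 2 * N * D * s + 2 * N * D * t := by
    have e2 := three_mul_sum_sum_fiberCard_sq S
    have e3 := nine_mul_sum_sum_fiberCard_cube hS
    simp only [hg, Finset.sum_add_distrib, ← Finset.mul_sum, Finset.sum_const, nsmul_eq_mul,
      Finset.card_univ, ← hD]
    rw [← hD, ← hN] at e2 e3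
    linear_combination s * e3 + (t - 3 * s * N) * e2
  have hzero : g 0 = 2 * N ^ 3 * s + 2 * N ^ 2 * t := by
    have z0 : fiberCard S 0 0 = N := by simp [fiberCard, hN]
    have z1 : fiberCard S 0 1 = 0 := by simp [fiberCard]
    have z2 : fiberCard S 0 2 = 0 := by
      simp [fiberCard, show ((0 : ZMod 3) = 2) = False from by simp; decide]
    simp only [g, z0, z1, z2]
    ring
  by_contra! hcon
  have hnn : 0 ≤ ∑ ℓ ∈ Finset.univ.erase 0, g ℓ :=
    Finset.sum_nonneg fun ℓ hℓ => hcon ℓ (Finset.ne_of_mem_erase hℓ)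
  have := Finset.add_sum_erase Finset.univ g (Finset.mem_univ 0)
  rw [hsum, hzero] at this
  nlinarith

end Moments

/-- The affine plane over the field of three elements. -/
abbrev V2 := ZMod 3 × ZMod 3

/-- Three-dimensional affine space over the field of three elements. -/
abbrev V3 := V2 × ZMod 3

/-- Four-dimensional affine space over the field of three elements. -/
abbrev V4 := V3 × ZMod 3

/-- Five-dimensional affine space over the field of three elements. -/
abbrev V5 := V4 × ZMod 3

theorem IsSumFreeCap.subset {G : Type*} [AddCommGroup G] {S T : Finset G} (hT : IsSumFreeCap T)
    (h : S ⊆ T) : IsSumFreeCap S :=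
  fun a ha b hb c hc => hT a (h ha) b (h hb) c (h hc)

/-- `T` is the image of `S` under an injective affine map. -/
def IsAffineImage {G H : Type*} [AddCommGroup G] [AddCommGroup H] [DecidableEq H]
    (S : Finset G) (T : Finset H) : Prop :=
  ∃ (f : G →+ H) (t : H), Function.Injective f ∧ T = S.image fun x => f x + t

namespace IsAffineImage

variable {G H K : Type*} [AddCommGroup G] [AddCommGroup H] [AddCommGroup K]
  [DecidableEq H] [DecidableEq K] {S : Finset G} {T : Finset H} {U : Finset K}

theorem trans (h : IsAffineImage S T) (h' : IsAffineImage T U) : IsAffineImage S U := by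
  obtain ⟨f, t, hf, rfl⟩ := h
  obtain ⟨g, u, hg, rfl⟩ := h'
  refine ⟨g.comp f, g t + u, hg.comp hf, ?_⟩
  rw [Finset.image_image]
  congr 1
  funext x
  simp [add_assoc]

theorem translate (T : Finset H) (t : H) : IsAffineImage T (T.image (· + t)) :=
  ⟨AddMonoidHom.id H, t, Function.injective_id, rfl⟩

theorem of_hom (f : G →+ H) (hf : Function.Injective f) (S : Finset G) :
    IsAffineImage S (S.image f) :=
  ⟨f, 0, hf, by simp⟩

theorem card_eq (h : IsAffineImage S T) : T.card = S.card := by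
  obtain ⟨f, t, hf, rfl⟩ := h
  exact Finset.card_image_of_injective _ fun x y hxy => hf (add_right_cancel hxy)

theorem isSumFreeCap [Module (ZMod 3) H] (h : IsAffineImage S T) (hS : IsSumFreeCap S) :
    IsSumFreeCap T := by
  obtain ⟨f, t, hf, rfl⟩ := h
  simp only [IsSumFreeCap, Finset.forall_mem_image]
  intro a ha b hb c hc hab hac hbc h0
  refine hS a ha b hb c hc (fun h => hab (by rw [h])) (fun h => hac (by rw [h]))
    (fun h => hbc (by rw [h])) (hf ?_)
  rw [map_zero, ← h0, map_add, map_add]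
  have := add_add_self_eq_zero t
  calc f a + f b + f c = f a + f b + f c + (t + t + t) := by rw [this, add_zero]
    _ = _ := by abel

end IsAffineImage

section Slices

variable {W : Type*} [AddCommGroup W] [Fintype W] [DecidableEq W]

/-- The points of `S` with last coordinate `i`. -/
def slice (S : Finset (W × ZMod 3)) (i : ZMod 3) : Finset W :=
  Finset.univ.filter fun w => (w, i) ∈ S

@[simp]
theorem mem_slice {S : Finset (W × ZMod 3)} {i : ZMod 3} {w : W} :
    w ∈ slice S i ↔ (w, i) ∈ S := by
  simp [slice]

theorem card_slice (S : Finset (W × ZMod 3)) (i : ZMod 3) :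
    (slice S i).card = (S.filter fun x => x.2 = i).card := by
  refine Finset.card_nbij' (fun w => (w, i)) Prod.fst ?_ ?_ ?_ ?_
  · intro w hw
    simpa using hw
  · rintro ⟨w, j⟩ hw
    simp only [Finset.coe_filter, Set.mem_ofPred_eq] at hw
    obtain ⟨hw, rfl⟩ := hw
    simpa using hw
  · intro w _
    rfl
  · rintro ⟨w, j⟩ hw
    simp only [Finset.coe_filter, Set.mem_ofPred_eq] at hw
    rw [← hw.2]

theorem card_slice_add (S : Finset (W × ZMod 3)) :
    (slice S 0).card + (slice S 1).card + (slice S 2).card = S.card := by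
  have h : S.card = ∑ i : ZMod 3, (S.filter fun x => x.2 = i).card :=
    Finset.card_eq_sum_card_fiberwise (fun _ _ => Finset.mem_coe.2 (Finset.mem_univ _))
  rw [card_slice, card_slice, card_slice, h]
  exact (Fin.sum_univ_three fun i : ZMod 3 => (S.filter fun x => x.2 = i).card).symm

/-- No three points taken one from each of the sets sum to zero. -/
def IsSumFreeTriple {G : Type*} [AddCommGroup G] (A B C : Finset G) : Prop :=
  ∀ a ∈ A, ∀ b ∈ B, ∀ c ∈ C, a + b + c ≠ 0

theorem IsSumFreeCap.isSumFreeCap_slice [Module (ZMod 3) W] {S : Finset (W × ZMod 3)}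
    (hS : IsSumFreeCap S) (i : ZMod 3) : IsSumFreeCap (slice S i) := by
  intro a ha b hb c hc hab hac hbc h
  rw [mem_slice] at ha hb hc
  refine hS _ ha _ hb _ hc (by simpa using hab) (by simpa using hac) (by simpa using hbc) ?_
  exact Prod.ext h (add_add_self_eq_zero i)

theorem IsSumFreeCap.isSumFreeTriple_slice {S : Finset (W × ZMod 3)} (hS : IsSumFreeCap S)
    {i j k : ZMod 3} (hij : i ≠ j) (hik : i ≠ k) (hjk : j ≠ k) :
    IsSumFreeTriple (slice S i) (slice S j) (slice S k) := by
  intro a ha b hb c hc h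
  rw [mem_slice] at ha hb hc
  refine hS _ ha _ hb _ hc (by simp [hij]) (by simp [hik]) (by simp [hjk]) ?_
  have key : ∀ i j k : ZMod 3, i ≠ j → i ≠ k → j ≠ k → i + j + k = 0 := by decide
  exact Prod.ext h (key i j k hij hik hjk)

/-- The slices of a set can be moved by one injective linear map followed by translations
whose vectors sum to zero. -/
theorem exists_isAffineImage_slice [Module (ZMod 3) W] (S : Finset (W × ZMod 3)) (f : W →+ W)
    (hf : Function.Injective f) (u : ZMod 3 → W) (hu : u 0 + u 1 + u 2 = 0) :
    ∃ S' : Finset (W × ZMod 3), IsAffineImage S S' ∧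
      ∀ i, slice S' i = (slice S i).image fun w => f w + u i := by
  let g : W × ZMod 3 →+ W × ZMod 3 :=
    { toFun := fun x => (f x.1 + x.2 • (u 1 - u 0), x.2)
      map_zero' := by simp
      map_add' := fun x y => by
        refine Prod.ext ?_ rfl
        simp only [Prod.fst_add, Prod.snd_add, map_add, add_smul]
        abel }
  have hg : Function.Injective g := by
    rintro ⟨x, i⟩ ⟨y, j⟩ h
    have h2 : i = j := congrArg Prod.snd h
    subst h2
    have h1 : f x + i • (u 1 - u 0) = f y + i • (u 1 - u 0) := congrArg Prod.fst h
    rw [hf (add_right_cancel h1)]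
  have hshift : ∀ i, i • (u 1 - u 0) + u 0 = u i := by
    have hi : ∀ i : ZMod 3, i = 0 ∨ i = 1 ∨ i = 1 + 1 := by decide
    intro i
    rcases hi i with rfl | rfl | rfl
    · simp
    · simp
    · have h1 := add_add_self_eq_zero (u 1)
      rw [add_smul, one_smul, show (1 + 1 : ZMod 3) = 2 from rfl]
      calc u 1 - u 0 + (u 1 - u 0) + u 0
          = (u 1 + u 1 + u 1) - (u 0 + u 1 + u 2) + u 2 := by abel
        _ = u 2 := by rw [h1, hu]; simp
  refine ⟨S.image fun x => g x + (u 0, 0), ⟨g, _, hg, rfl⟩, fun i => ?_⟩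
  ext w
  simp only [mem_slice, Finset.mem_image, Prod.exists]
  constructor
  · rintro ⟨x, j, hx, h⟩
    have h2 : j + 0 = i := congrArg Prod.snd h
    have h1 : f x + j • (u 1 - u 0) + u 0 = w := congrArg Prod.fst h
    rw [add_zero] at h2
    subst h2
    exact ⟨x, hx, by rw [← h1, add_assoc, hshift]⟩
  · rintro ⟨x, hx, rfl⟩
    refine ⟨x, i, hx, Prod.ext ?_ (add_zero i)⟩
    change f x + i • (u 1 - u 0) + u 0 = _
    rw [add_assoc, hshift]

/-- A relabelling of the field of three elements sorts any function on it. -/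
theorem exists_affine_sorted (n : ZMod 3 → ℕ) :
    ∃ ε c : ZMod 3, ε * ε = 1 ∧ n (ε * (0 - c)) ≤ n (ε * (2 - c)) ∧
      n (ε * (2 - c)) ≤ n (ε * (1 - c)) := by
  have key : ∀ i j k : ZMod 3, i ≠ j → i ≠ k → j ≠ k →
      ∃ ε c : ZMod 3, ε * ε = 1 ∧ ε * (0 - c) = i ∧ ε * (2 - c) = j ∧ ε * (1 - c) = k := by
    decide
  obtain ⟨i, j, k, hij, hik, hjk, h1, h2⟩ : ∃ i j k : ZMod 3, i ≠ j ∧ i ≠ k ∧ j ≠ k ∧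
      n i ≤ n j ∧ n j ≤ n k := by
    have h01 : (0 : ZMod 3) ≠ 1 := by decide
    have h02 : (0 : ZMod 3) ≠ 2 := by decide
    have h12 : (1 : ZMod 3) ≠ 2 := by decide
    rcases le_total (n 0) (n 1) with a | a <;> rcases le_total (n 0) (n 2) with b | b <;>
      rcases le_total (n 1) (n 2) with c | c
    · exact ⟨0, 1, 2, h01, h02, h12, a, c⟩
    · exact ⟨0, 2, 1, h02, h01, h12.symm, b, c⟩
    · exact ⟨0, 1, 2, h01, h02, h12, a, c⟩
    · exact ⟨2, 0, 1, h02.symm, h12.symm, h01, b, a⟩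
    · exact ⟨1, 0, 2, h01.symm, h12, h02, a, b⟩
    · exact ⟨2, 1, 0, h12.symm, h02.symm, h01.symm, c, a⟩
    · exact ⟨1, 2, 0, h12, h01.symm, h02.symm, c, b⟩
    · exact ⟨2, 1, 0, h12.symm, h02.symm, h01.symm, c, a⟩
  obtain ⟨ε, c, hε, rfl, rfl, rfl⟩ := key i j k hij hik hjk
  exact ⟨ε, c, hε, h1, h2⟩

/-- A nonzero functional can be made the last coordinate. -/
theorem exists_injective_snd_eq [Module (ZMod 3) W] (ℓ : Module.Dual (ZMod 3) (W × ZMod 3))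
    (hℓ : ℓ ≠ 0) :
    ∃ f : W × ZMod 3 →+ W × ZMod 3, Function.Injective f ∧ ∀ x, (f x).2 = ℓ x := by
  have : Fact (Nat.Prime 3) := ⟨by norm_num⟩
  have hfin : Module.Finite (ZMod 3) W := Module.finite_iff_finite.2 inferInstance
  obtain ⟨v, hv⟩ : ∃ v, ℓ v ≠ 0 := by
    by_contra! h
    exact hℓ (LinearMap.ext h)
  have hrank : Module.finrank (ZMod 3) ℓ.ker = Module.finrank (ZMod 3) W := by
    have h := Module.Dual.finrank_ker_add_one_of_ne_zero hℓ
    rw [Module.finrank_prod, Module.finrank_self] at h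
    omega
  let φ := LinearEquiv.ofFinrankEq _ _ hrank
  let u := (ℓ v)⁻¹ • v
  have hu : ℓ u = 1 := by simp [u, inv_mul_cancel₀ hv]
  have hker : ∀ x, x - ℓ x • u ∈ ℓ.ker := fun x => by simp [LinearMap.mem_ker, hu]
  refine ⟨{ toFun := fun x => (φ ⟨x - ℓ x • u, hker x⟩, ℓ x), map_zero' := ?_, map_add' := ?_ },
    ?_, fun x => rfl⟩
  · refine Prod.ext ?_ (map_zero ℓ)
    rw [Prod.fst_zero, LinearEquiv.map_eq_zero_iff]
    exact Subtype.ext (by simp)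
  · intro x y
    refine Prod.ext ?_ (map_add ℓ x y)
    rw [Prod.fst_add, ← map_add]
    change φ _ = φ _
    congr 1
    refine Subtype.ext ?_
    simp only [map_add, add_smul, Submodule.coe_add]
    abel
  · intro x y h
    have h2 : ℓ x = ℓ y := congrArg Prod.snd h
    have h1 := congrArg Subtype.val (φ.injective (congrArg Prod.fst h))
    simp only [h2] at h1
    exact sub_left_injective h1

theorem card_dual_eq {V : Type*} [AddCommGroup V] [Module (ZMod 3) V] [Fintype V]
    [Fintype (Module.Dual (ZMod 3) V)] :
    Fintype.card (Module.Dual (ZMod 3) V) = Fintype.card V := by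
  have : Fact (Nat.Prime 3) := ⟨by norm_num⟩
  have hfin : Module.Finite (ZMod 3) V := Module.finite_iff_finite.2 inferInstance
  rw [Module.card_eq_pow_finrank (K := ZMod 3) (V := V),
    Module.card_eq_pow_finrank (K := ZMod 3), Subspace.dual_finrank_eq]

/-- The expression whose weighted average over all functionals is controlled for caps. -/
def sliceWeight (s t a b c : ℤ) : ℤ :=
  s * ((3 * a - (a + b + c)) * (3 * b - (a + b + c)) * (3 * c - (a + b + c))) +
    t * (3 * (a ^ 2 + b ^ 2 + c ^ 2) - (a + b + c) ^ 2)

/-- Every cap has, up to an affine map, sorted slices of negative weight. -/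
theorem IsSumFreeCap.exists_sorted_slices [Module (ZMod 3) W] {S : Finset (W × ZMod 3)}
    (hS : IsSumFreeCap S) (s t : ℤ)
    (h : s * (S.card * ((Fintype.card W * 3 : ℕ) - (S.card : ℤ) ^ 2)) +
      t * (S.card * ((Fintype.card W * 3 : ℕ) - (S.card : ℤ))) < 0) :
    ∃ T : Finset (W × ZMod 3), IsAffineImage S T ∧
      (slice T 0).card ≤ (slice T 2).card ∧
      (slice T 2).card ≤ (slice T 1).card ∧
      sliceWeight s t (slice T 0).card (slice T 1).card
        (slice T 2).card < 0 := by
  have hcases : ∀ ε c : ZMod 3, ε * ε = 1 → (ε = 1 ∨ ε = 2) ∧ (c = 0 ∨ c = 1 ∨ c = 2) := by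
    decide
  classical
  have : Fact (Nat.Prime 3) := ⟨by norm_num⟩
  have : Finite (Module.Dual (ZMod 3) (W × ZMod 3)) :=
    Finite.of_injective (fun ℓ x => ℓ x : _ → W × ZMod 3 → ZMod 3) DFunLike.coe_injective
  have := Fintype.ofFinite (Module.Dual (ZMod 3) (W × ZMod 3))
  obtain ⟨ℓ, hℓ, hlt⟩ := exists_dual_fiberCard_lt hS s t (by
    rw [card_dual_eq, Fintype.card_prod, ZMod.card]
    exact h)
  obtain ⟨f, hf, hfℓ⟩ := exists_injective_snd_eq ℓ hℓ
  obtain ⟨ε, c, hε, h02, h21⟩ :=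
    exists_affine_sorted fun i => (S.filter fun x => ℓ x = i).card
  let r : W × ZMod 3 →+ W × ZMod 3 :=
    AddMonoidHom.prodMap (AddMonoidHom.id W) (AddMonoidHom.mulLeft ε)
  have hr : Function.Injective r := by
    rintro ⟨x, i⟩ ⟨y, j⟩ hxy
    have h1 : x = y := congrArg Prod.fst hxy
    have h2 : ε * i = ε * j := congrArg Prod.snd hxy
    have h3 : i = j := by
      calc i = ε * (ε * i) := by rw [← mul_assoc, hε, one_mul]
        _ = j := by rw [h2, ← mul_assoc, hε, one_mul]
    rw [h1, h3]
  have hinj : Function.Injective fun x => r.comp f x + (0, c) :=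
    fun x y hxy => (hr.comp hf) (add_right_cancel hxy)
  have hcard : ∀ i, (slice (S.image fun x => r.comp f x + (0, c)) i).card =
      (S.filter fun x => ℓ x = ε * (i - c)).card := by
    intro i
    rw [card_slice, Finset.filter_image, Finset.card_image_of_injective _ hinj]
    congr 1
    refine Finset.filter_congr fun x _ => ?_
    change ε * (f x).2 + c = i ↔ _
    rw [hfℓ, ← eq_sub_iff_add_eq]
    constructor
    · intro hx
      rw [← hx, ← mul_assoc, hε, one_mul]
    · intro hx
      rw [hx, ← mul_assoc, hε, one_mul]
  refine ⟨S.image fun x => r.comp f x + (0, c), ⟨r.comp f, (0, c), hr.comp hf, rfl⟩, ?_⟩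
  simp only [hcard]
  refine ⟨h02, h21, ?_⟩
  have hN := (sum_fiberCard S ℓ).symm.trans (Fin.sum_univ_three _)
  have hperm : ∀ ε c : ZMod 3, ε * ε = 1 → ∀ n : ZMod 3 → ℤ,
      sliceWeight s t (n (ε * (0 - c))) (n (ε * (1 - c))) (n (ε * (2 - c))) =
        sliceWeight s t (n 0) (n 1) (n 2) := by
    intro ε c hε n
    obtain ⟨rfl | rfl, rfl | rfl | rfl⟩ := hcases ε c hε
    all_goals
      unfold sliceWeight
      reduce_mod_char
      try ring
  have := hperm ε c hε (fiberCard S ℓ)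
  unfold fiberCard at this
  rw [this]
  unfold sliceWeight
  change _ = fiberCard S ℓ 0 + fiberCard S ℓ 1 + fiberCard S ℓ 2 at hN
  rw [hN] at hlt
  exact hlt

end Slices

section Search

/-- `allTails f l` checks `f` on every element of `l` together with the rest of the list. -/
def allTails (f : ℕ → List ℕ → Bool) (l : List ℕ) : Bool :=
  List.rec true (fun p l ih => cond (f p l) ih false) l

/-- A point of three-dimensional space written with digits to base five, so that adding codes
causes no carries. -/
def code (v : V3) : ℕ :=
  v.1.1.val + 5 * v.1.2.val + 25 * v.2.val

/-- The code of the third point on the line through two coded points: block `s` of seven bits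
in the table is the code of `-v` when `s` is the sum of two codes of points with sum `v`. -/
def third (p q : ℕ) : ℕ :=
  Nat.mod (Nat.shiftRight
    122949040107849541151353661405957602097181123963738515383361921862541193108461157275926599826379280194384583904963408642760221623563587947329903390349873617155151915751080191866255632626981806663599979362874904953627169883541361558588056115833178072214357170733312
    (Nat.mul 7 (Nat.add p q))) 128

/-- The codes of all points. -/
def points : List ℕ :=
  [0, 1, 2, 5, 6, 7, 10, 11, 12, 25, 26, 27, 30, 31, 32, 35, 36, 37, 50, 51, 52, 55, 56, 57, 60,
    61, 62]

theorem third_code (v w : V3) :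
    third (code v) (code w) = code (-v - w) := by
  revert v w
  decide +kernel

theorem code_injective : Function.Injective code := by
  unfold Function.Injective
  decide +kernel

theorem code_mem_points (v : V3) : code v ∈ points := by
  revert v
  decide +kernel

/-- Whether bit `x` of `m` is set. -/
def bit (m x : ℕ) : Bool :=
  Nat.beq (Nat.mod (Nat.shiftRight m x) 2) 1

/-- Pass a number to `f` in evaluated form. -/
def withValue (m : ℕ) (f : ℕ → Bool) : Bool :=
  Nat.rec (f 0) (fun k _ => f (Nat.succ k)) m

/-- The bit mask of the third points on the lines through `p` and a point of a list. -/
def blocked (p : ℕ) (l : List ℕ) : ℕ :=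
  List.rec 0 (fun q _ ih => Nat.lor ih (Nat.shiftLeft 1 (third p q))) l

/-- Pass the elements of a list whose bit in `m` is not set to a continuation, evaluating the
list first. -/
def unblockedThen (m : ℕ) (k : List ℕ → Bool) (l : List ℕ) : Bool :=
  List.rec (motive := fun _ => List ℕ → Bool) k
    (fun x _ ih acc => cond (bit m x) (ih acc) (ih (x :: acc))) l []

/-- Whether a list has at most `n` elements. -/
def isShort (n : ℕ) (l : List ℕ) : Bool :=
  List.rec (motive := fun _ => ℕ → Bool) (fun _ => true)
    (fun _ _ ih n => Nat.rec false (fun k _ => ih k) n) l n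

/-- Exhaustive search showing that no cap contains `chosen` and `n` more points of `allowed`. -/
def noCap (n : ℕ) : List ℕ → List ℕ → Bool :=
  Nat.rec (motive := fun _ => List ℕ → List ℕ → Bool) (fun _ _ => false)
    (fun n ih chosen allowed =>
      allTails (fun p rest =>
        cond (isShort n (p :: rest)) true <|
        withValue (blocked p chosen) fun m =>
          unblockedThen m (ih (p :: chosen)) rest) allowed) n

/-- Exhaustive search showing that, given a set `A` coded by a bit mask, there are no caps
`B ⊆ D` with `m + 1` points and `C` containing `chosen` and `k` more points of `allowed` for which
`A`, `B`, `C` is a sum-free triple. -/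
def noPair (A : List ℕ) (m k : ℕ) : List ℕ → List ℕ → List ℕ → Bool :=
  Nat.rec (motive := fun _ => List ℕ → List ℕ → List ℕ → Bool) (fun _ _ D => noCap (m + 1) [] D)
    (fun _ ih chosen allowed D =>
      allTails (fun c rest =>
        withValue (blocked c A) fun b => unblockedThen b
          (fun D' => cond (isShort m D') true <| withValue (blocked c chosen) fun l =>
            unblockedThen l (fun rest' => ih (c :: chosen) rest' D') rest) D) allowed) k

end Search

section SearchSound

/-- No three distinct codes in the set are the codes of collinear points. -/
def IsCodedCap (s : Finset ℕ) : Prop :=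
  ∀ p ∈ s, ∀ q ∈ s, p ≠ q → third p q ∉ s

@[simp]
theorem allTails_cons (f : ℕ → List ℕ → Bool) (p : ℕ) (l : List ℕ) :
    allTails f (p :: l) = true ↔ f p l = true ∧ allTails f l = true := by
  change cond (f p l) (allTails f l) false = true ↔ _
  cases f p l <;> simp

theorem bit_eq_testBit (m x : ℕ) : bit m x = m.testBit x := by
  rw [Nat.testBit_eq_decide_div_mod_eq, ← Nat.shiftRight_eq_div_pow]
  change Nat.beq ((m >>> x) % 2) 1 = _
  rw [Bool.eq_iff_iff, decide_eq_true_iff, Nat.beq_eq]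

theorem bit_blocked (p x : ℕ) (l : List ℕ) :
    bit (blocked p l) x = true ↔ ∃ q ∈ l, third p q = x := by
  rw [bit_eq_testBit]
  induction l with
  | nil => simp [blocked]
  | cons q l ih =>
    change (blocked p l ||| 1 <<< third p q).testBit x = true ↔ _
    rw [Nat.testBit_or, Nat.one_shiftLeft, Nat.testBit_two_pow, Bool.or_eq_true, ih,
      decide_eq_true_iff]
    simp [or_comm]

theorem withValue_eq (m : ℕ) (f : ℕ → Bool) : withValue m f = f m := by
  cases m <;> rfl

theorem unblockedThen_eq (m : ℕ) (k : List ℕ → Bool) (l : List ℕ) :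
    unblockedThen m k l = k (l.filter fun x => !(bit m x)).reverse := by
  have key : ∀ acc : List ℕ, (List.rec (motive := fun _ => List ℕ → Bool) k
      (fun x _ ih acc => cond (bit m x) (ih acc) (ih (x :: acc))) l : List ℕ → Bool) acc =
        k ((l.filter fun x => !(bit m x)).reverse ++ acc) := by
    induction l with
    | nil => intro acc; rfl
    | cons x l ih =>
      intro acc
      cases h : bit m x <;> simp [h, ih]
  have h := key []
  rw [List.append_nil] at h
  exact h

theorem length_le_of_isShort {n : ℕ} {l : List ℕ} (h : isShort n l = true) : l.length ≤ n := by
  induction l generalizing n with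
  | nil => simp
  | cons x l ih =>
    cases n with
    | zero => exact absurd h Bool.false_ne_true
    | succ n => simpa using ih h

/-- Deleting blocked points does not lose points of a cap. -/
theorem filter_mem_unblocked {s : Finset ℕ} {p : ℕ} {ch l : List ℕ}
    (h : ∀ q ∈ ch, third p q ∉ s) :
    (((l.filter fun x => !(bit (blocked p ch) x)).reverse).filter (· ∈ s)).length =
      (l.filter (· ∈ s)).length := by
  rw [List.filter_reverse, List.length_reverse, List.filter_filter]
  congr 1
  refine List.filter_congr fun x _ => ?_
  by_cases hx : x ∈ s
  · have hb : bit (blocked p ch) x = false := by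
      rw [Bool.eq_false_iff, Ne, bit_blocked]
      rintro ⟨q, hq, rfl⟩
      exact h q hq hx
    simp [hb]
  · simp [hx]

theorem length_filter_lt_of_noCap {s : Finset ℕ} (hs : IsCodedCap s) {n : ℕ} {ch al : List ℕ}
    (h : noCap n ch al = true) (hch : ∀ q ∈ ch, q ∈ s) (hal : (ch ++ al).Nodup) :
    (al.filter (· ∈ s)).length < n := by
  induction n generalizing ch al with
  | zero => exact absurd h Bool.false_ne_true
  | succ n ih =>
    change allTails _ al = true at h
    induction al with
    | nil => simp
    | cons p l ihl =>
      rw [allTails_cons] at h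
      obtain ⟨h1, h2⟩ := h
      have hal' := List.nodup_middle.1 hal
      have hrec := ihl (List.nodup_cons.1 hal').2 h2
      by_cases hp : p ∈ s
      · cases hsh : isShort n (p :: l) with
        | true =>
          exact ((List.length_filter_le _ _).trans (length_le_of_isShort hsh)).trans_lt
            (Nat.lt_succ_self n)
        | false =>
          rw [hsh, cond_false, withValue_eq, unblockedThen_eq] at h1
          have hne : ∀ q ∈ ch, third p q ∉ s := fun q hq => by
            refine hs p hp q (hch q hq) ?_
            rintro rfl
            exact (List.nodup_cons.1 hal').1 (List.mem_append_left _ hq)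
          have := ih h1 (by simpa [hp] using hch) (by
            have hsub : (p :: ch ++ (l.filter fun x => !(bit (blocked p ch) x)).reverse).Perm
                (p :: ch ++ (l.filter fun x => !(bit (blocked p ch) x))) :=
              (List.reverse_perm _).append_left _
            rw [hsub.nodup_iff]
            exact (List.Sublist.append_left List.filter_sublist _).nodup hal')
          rw [filter_mem_unblocked hne] at this
          rw [List.filter_cons_of_pos (by simpa using hp), List.length_cons]
          omega
      · rwa [List.filter_cons_of_neg (by simpa using hp)]

theorem length_filter_le_of_noPair {s t : Finset ℕ} (hs : IsCodedCap s) (ht : IsCodedCap t)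
    {A : List ℕ} (hA : ∀ c ∈ s, ∀ a ∈ A, third c a ∉ t) {m k : ℕ} {ch al D : List ℕ}
    (h : noPair A m k ch al D = true) (hch : ∀ q ∈ ch, q ∈ s) (hal : (ch ++ al).Nodup)
    (hD : D.Nodup) (hk : k ≤ (al.filter (· ∈ s)).length) :
    (D.filter (· ∈ t)).length ≤ m := by
  induction k generalizing ch al D with
  | zero => exact Nat.lt_succ_iff.1 (length_filter_lt_of_noCap ht h (by simp) (by simpa using hD))
  | succ k ih =>
    change allTails _ al = true at h
    induction al with
    | nil => simp at hk
    | cons p l ihl =>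
      rw [allTails_cons] at h
      obtain ⟨h1, h2⟩ := h
      have hal' := List.nodup_middle.1 hal
      by_cases hp : p ∈ s
      · rw [withValue_eq, unblockedThen_eq] at h1
        rw [List.filter_cons_of_pos (by simpa using hp), List.length_cons] at hk
        rw [← filter_mem_unblocked (hA p hp)]
        cases hsh : isShort m (D.filter fun x => !(bit (blocked p A) x)).reverse with
        | true => exact (List.length_filter_le _ _).trans (length_le_of_isShort hsh)
        | false =>
          rw [hsh, cond_false, withValue_eq, unblockedThen_eq] at h1
          have hne : ∀ q ∈ ch, third p q ∉ s := fun q hq => by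
            refine hs p hp q (hch q hq) ?_
            rintro rfl
            exact (List.nodup_cons.1 hal').1 (List.mem_append_left _ hq)
          refine ih h1 (by simpa [hp] using hch) ?_ (List.nodup_reverse.2 (hD.filter _)) ?_
          · have hsub : (p :: ch ++ (l.filter fun x => !(bit (blocked p ch) x)).reverse).Perm
                (p :: ch ++ (l.filter fun x => !(bit (blocked p ch) x))) :=
              (List.reverse_perm _).append_left _
            rw [hsub.nodup_iff]
            exact (List.Sublist.append_left List.filter_sublist _).nodup hal'
          · rw [filter_mem_unblocked hne]
            omega
      · rw [List.filter_cons_of_neg (by simpa using hp)] at hk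
        exact ihl (List.nodup_cons.1 hal').2 hk h2

theorem IsSumFreeCap.isCodedCap {S : Finset V3} (hS : IsSumFreeCap S) :
    IsCodedCap (S.image code) := by
  simp only [IsCodedCap, Finset.forall_mem_image]
  intro v hv w hw hvw h
  rw [third_code, code_injective.mem_finset_image] at h
  replace hvw : v ≠ w := fun h => hvw (by rw [h])
  have h3 : ∀ v w : V3, v ≠ w → v ≠ -v - w ∧ w ≠ -v - w := by
    decide +kernel
  obtain ⟨h1, h2⟩ := h3 v w hvw
  exact hS v hv w hw _ h hvw h1 h2 (by abel)

theorem length_filter_mem_eq_card {s : Finset ℕ} {l : List ℕ} (hl : l.Nodup) (h : ∀ x ∈ s, x ∈ l) :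
    (l.filter (· ∈ s)).length = s.card := by
  rw [← List.toFinset_card_of_nodup (hl.filter _)]
  congr 1
  ext x
  simpa using h x

theorem card_lt_of_noCap {S : Finset V3} (hS : IsSumFreeCap S) {n : ℕ}
    {ch al : List ℕ} (h : noCap n ch al = true) (hch : ∀ q ∈ ch, q ∈ S.image code)
    (hal : (ch ++ al).Nodup) (hSal : ∀ v ∈ S, code v ∈ ch ++ al) : S.card < ch.length + n := by
  have h1 := length_filter_lt_of_noCap hS.isCodedCap h hch hal
  have h2 := length_filter_mem_eq_card (s := S.image code) hal (Finset.forall_mem_image.2 hSal)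
  rw [Finset.card_image_of_injective _ code_injective, List.filter_append, List.length_append,
    List.filter_eq_self.2 (by simpa using hch)] at h2
  omega

theorem card_le_of_noPair {A B C : Finset V3} (hB : IsSumFreeCap B)
    (hC : IsSumFreeCap C) (hABC : IsSumFreeTriple A B C) {l : List ℕ}
    (hl : ∀ a ∈ l, a ∈ A.image code) {m k : ℕ} {ch al D : List ℕ}
    (h : noPair l m k ch al D = true) (hch : ∀ q ∈ ch, q ∈ C.image code)
    (hal : (ch ++ al).Nodup) (hCal : ∀ v ∈ C, code v ∈ ch ++ al) (hk : ch.length + k ≤ C.card)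
    (hD : D.Nodup) (hBD : ∀ v ∈ B, code v ∈ D) : B.card ≤ m := by
  have h2 := length_filter_mem_eq_card (s := C.image code) hal (Finset.forall_mem_image.2 hCal)
  rw [Finset.card_image_of_injective _ code_injective, List.filter_append, List.length_append,
    List.filter_eq_self.2 (by simpa using hch)] at h2
  have h1 := length_filter_le_of_noPair hC.isCodedCap hB.isCodedCap (A := l) (by
    simp only [Finset.forall_mem_image]
    intro c hc a ha
    obtain ⟨a, haA, rfl⟩ := Finset.mem_image.1 (hl a ha)
    rw [third_code, code_injective.mem_finset_image]
    exact fun hb => hABC a haA _ hb c hc (by abel)) h hch hal hD (by omega)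
  rwa [length_filter_mem_eq_card hD (Finset.forall_mem_image.2 hBD),
    Finset.card_image_of_injective _ code_injective] at h1

/-- Search for pairs of caps completing a coded set `A`, the second of which contains zero. -/
def pairSearch (A : List ℕ) (m k : ℕ) : Bool :=
  unblockedThen (blocked 0 A) (noPair A m k [0] points.tail) points

theorem card_le_of_pairSearch {A B C : Finset V3} (hB : IsSumFreeCap B)
    (hC : IsSumFreeCap C) (hABC : IsSumFreeTriple A B C) {l : List ℕ}
    (hl : ∀ a ∈ l, a ∈ A.image code) {m k : ℕ} (h : pairSearch l m k = true) (h0 : 0 ∈ C)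
    (hk : k < C.card) : B.card ≤ m := by
  rw [pairSearch, unblockedThen_eq] at h
  refine card_le_of_noPair hB hC hABC hl h ?_ (by decide) (fun v _ => code_mem_points v) ?_
    (List.nodup_reverse.2 (List.Nodup.filter _ (by decide))) fun v hv => ?_
  · intro q hq
    rw [List.mem_singleton.1 hq]
    exact Finset.mem_image.2 ⟨0, h0, rfl⟩
  · simpa [add_comm] using hk
  · rw [List.mem_reverse, List.mem_filter]
    refine ⟨code_mem_points v, ?_⟩
    rw [Bool.not_eq_true', Bool.eq_false_iff, Ne, bit_blocked]
    rintro ⟨a, ha, hav⟩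
    obtain ⟨a, haA, rfl⟩ := Finset.mem_image.1 (hl a ha)
    have hc : third (code 0) (code a) = code v := hav
    rw [third_code] at hc
    have := code_injective hc
    refine hABC a haA v hv 0 h0 ?_
    rw [← this]
    abel

theorem card_le_of_pairSearch_of_lt_card {A B C : Finset V3}
    (hB : IsSumFreeCap B) (hC : IsSumFreeCap C) (hABC : IsSumFreeTriple A B C) {l : List ℕ}
    (hl : ∀ a ∈ l, a ∈ A.image code) {m k : ℕ} (h : pairSearch l m k = true)
    (hk : k < C.card) : B.card ≤ m := by
  obtain ⟨c, hc⟩ : C.Nonempty := Finset.card_pos.1 (Nat.zero_lt_of_lt hk)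
  rw [← (IsAffineImage.translate B c).card_eq]
  refine card_le_of_pairSearch ((IsAffineImage.translate B c).isSumFreeCap hB)
    ((IsAffineImage.translate C (-c)).isSumFreeCap hC) ?_ hl h
    (Finset.mem_image.2 ⟨c, hc, add_neg_cancel c⟩)
    (hk.trans_eq (IsAffineImage.translate C (-c)).card_eq.symm)
  simp only [IsSumFreeTriple, Finset.forall_mem_image]
  intro a ha x hx y hy h
  refine hABC a ha x hx y hy ?_
  rw [← h]
  abel

end SearchSound

section SmallCaps

theorem IsSumFreeCap.card_le_two {S : Finset (ZMod 3)} (hS : IsSumFreeCap S) : S.card ≤ 2 := by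
  by_contra! h
  have huniv : S = Finset.univ :=
    Finset.eq_univ_of_card S (le_antisymm (Finset.card_le_univ S) (by rw [ZMod.card]; omega))
  subst huniv
  exact hS 0 (Finset.mem_univ _) 1 (Finset.mem_univ _) 2 (Finset.mem_univ _) (by decide)
    (by decide) (by decide) (by decide)

variable {W : Type*} [AddCommGroup W] [Fintype W] [DecidableEq W] [Module (ZMod 3) W]

/-- The slice sizes allowed by the weighted average, for caps with `n` points whose slices have
at most `r` points, all satisfy `p`. -/
def SliceSizesSatisfy (n r : ℕ) (s t : ℤ) (p : ℕ → ℕ → ℕ → Bool) : Prop :=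
  ∀ a < r + 1, ∀ b < r + 1, ∀ c < r + 1,
    a ≤ c ∧ c ≤ b ∧ a + b + c = n ∧ sliceWeight s t a b c < 0 → p a b c = true

instance (n r : ℕ) (s t : ℤ) (p : ℕ → ℕ → ℕ → Bool) : Decidable (SliceSizesSatisfy n r s t p) := by
  unfold SliceSizesSatisfy
  infer_instance

theorem IsSumFreeCap.exists_slice_sizes {r : ℕ} (hr : ∀ S : Finset W, IsSumFreeCap S → S.card ≤ r)
    {S : Finset (W × ZMod 3)} (hS : IsSumFreeCap S) {n : ℕ} (hn : S.card = n) (s t : ℤ)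
    (h : s * (n * ((Fintype.card W * 3 : ℕ) - (n : ℤ) ^ 2)) +
      t * (n * ((Fintype.card W * 3 : ℕ) - (n : ℤ))) < 0)
    {p : ℕ → ℕ → ℕ → Bool} (hp : SliceSizesSatisfy n r s t p) :
    ∃ T : Finset (W × ZMod 3), IsAffineImage S T ∧ IsSumFreeCap T ∧
      p (slice T 0).card (slice T 1).card (slice T 2).card = true := by
  obtain ⟨T, hST, h02, h21, hw⟩ := hS.exists_sorted_slices s t (by rw [hn]; exact h)
  have hT := hST.isSumFreeCap hS
  have hlt : ∀ i, (slice T i).card < r + 1 := fun i =>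
    Nat.lt_succ_of_le (hr _ (hT.isSumFreeCap_slice i))
  exact ⟨T, hST, hT, hp _ (hlt 0) _ (hlt 1) _ (hlt 2) ⟨h02, h21,
    by rw [card_slice_add, hST.card_eq, hn], hw⟩⟩

theorem card_lt_of_sliceSizesSatisfy {r : ℕ}
    (hr : ∀ S : Finset W, IsSumFreeCap S → S.card ≤ r) {n : ℕ} (s t : ℤ)
    (h : s * (n * ((Fintype.card W * 3 : ℕ) - (n : ℤ) ^ 2)) +
      t * (n * ((Fintype.card W * 3 : ℕ) - (n : ℤ))) < 0)
    (hp : SliceSizesSatisfy n r s t fun _ _ _ => false)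
    {S : Finset (W × ZMod 3)} (hS : IsSumFreeCap S) : S.card < n := by
  by_contra! hn
  obtain ⟨S', hS', hcard⟩ := Finset.exists_subset_card_eq hn
  obtain ⟨T, -, -, hT⟩ := (hS.subset hS').exists_slice_sizes hr hcard s t h hp
  exact Bool.false_ne_true hT

theorem card_V2 : Fintype.card V2 = 9 := by
  simp only [Fintype.card_prod, ZMod.card]

theorem card_V3 : Fintype.card V3 = 27 := by
  simp only [Fintype.card_prod, ZMod.card]

theorem card_V4 : Fintype.card V4 = 81 := by
  simp only [Fintype.card_prod, ZMod.card]

theorem IsSumFreeCap.card_le_four {S : Finset V2} (hS : IsSumFreeCap S) : S.card ≤ 4 :=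
  Nat.le_of_lt_succ <| card_lt_of_sliceSizesSatisfy (n := 5) (fun _ h => h.card_le_two) 1 1
    (by rw [ZMod.card]; norm_num) (by decide +kernel) hS

theorem IsSumFreeCap.card_le_nine {S : Finset V3} (hS : IsSumFreeCap S) : S.card ≤ 9 :=
  Nat.le_of_lt_succ <| card_lt_of_sliceSizesSatisfy (n := 10) (fun _ h => h.card_le_four) 1 2
    (by rw [card_V2]; norm_num) (by decide +kernel) hS

theorem IsSumFreeCap.exists_slices_of_card_eq_eight {S : Finset V3} (hS : IsSumFreeCap S)
    (h : S.card = 8) : ∃ T : Finset V3, IsAffineImage S T ∧ IsSumFreeCap T ∧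
      (slice T 0).card = 0 ∧ (slice T 1).card = 4 ∧ (slice T 2).card = 4 := by
  obtain ⟨T, h1, h2, h3⟩ := hS.exists_slice_sizes (fun _ h => h.card_le_four) h 2 3
    (by rw [card_V2]; norm_num) (p := fun a b c => a == 0 && b == 4 && c == 4) (by decide +kernel)
  refine ⟨T, h1, h2, ?_⟩
  simpa [and_assoc] using h3

theorem IsSumFreeCap.exists_slices_of_card_eq_nine {S : Finset V3} (hS : IsSumFreeCap S)
    (h : S.card = 9) : ∃ T : Finset V3, IsAffineImage S T ∧ IsSumFreeCap T ∧
      (slice T 0).card = 1 ∧ (slice T 1).card = 4 ∧ (slice T 2).card = 4 := by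
  obtain ⟨T, h1, h2, h3⟩ := hS.exists_slice_sizes (fun _ h => h.card_le_four) h 1 2
    (by rw [card_V2]; norm_num) (p := fun a b c => a == 1 && b == 4 && c == 4) (by decide +kernel)
  refine ⟨T, h1, h2, ?_⟩
  simpa [and_assoc] using h3

theorem IsSumFreeCap.exists_slices_of_card_eq_nineteen {S : Finset V4} (hS : IsSumFreeCap S)
    (h : S.card = 19) : ∃ T : Finset V4, IsAffineImage S T ∧ IsSumFreeCap T ∧
      ((slice T 0).card = 1 ∧ (slice T 1).card = 9 ∧ (slice T 2).card = 9 ∨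
        (slice T 0).card = 2 ∧ (slice T 1).card = 9 ∧ (slice T 2).card = 8 ∨
        (slice T 0).card = 3 ∧ (slice T 1).card = 8 ∧ (slice T 2).card = 8) := by
  obtain ⟨T, h1, h2, h3⟩ := hS.exists_slice_sizes (fun _ h => h.card_le_nine) h 2 9
    (by rw [card_V3]; norm_num)
    (p := fun a b c => a == 1 && b == 9 && c == 9 || (a == 2 && b == 9 && c == 8 ||
      a == 3 && b == 8 && c == 8)) (by decide +kernel)
  refine ⟨T, h1, h2, ?_⟩
  simpa [and_assoc] using h3

/-- Four points of the plane without a line are the vertices of a parallelogram. -/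
theorem IsSumFreeCap.exists_parallelogram {S : Finset V2} (hS : IsSumFreeCap S)
    (h : S.card = 4) : ∃ m u v : V2, u ≠ 0 ∧ v ≠ 0 ∧ u ≠ v ∧ u ≠ -v ∧
      S = {m + u, m - u, m + v, m - v} := by
  obtain ⟨x, hx⟩ : S.Nonempty := Finset.card_pos.1 (by omega)
  obtain ⟨y, z, t, hyz, hyt, hzt, hS'⟩ := Finset.card_eq_three.1
    (show (S.erase x).card = 3 by rw [Finset.card_erase_of_mem hx, h])
  have hSx : S = {x, y, z, t} := by
    rw [← Finset.insert_erase hx, hS']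
  have hyx : y ∈ S.erase x := by simp [hS']
  have hzx : z ∈ S.erase x := by simp [hS']
  have htx : t ∈ S.erase x := by simp [hS']
  rw [Finset.mem_erase] at hyx hzx htx
  have key : ∀ p q r : V2, p ≠ 0 ∧ q ≠ 0 ∧ r ≠ 0 ∧ p ≠ q ∧ p ≠ r ∧ q ≠ r ∧ p + q ≠ 0 ∧
      p + r ≠ 0 ∧ q + r ≠ 0 ∧ p + q + r ≠ 0 → p + q = r ∨ p + r = q ∨ q + r = p := by
    decide +kernel
  have h3 := add_add_self_eq_zero x
  have hpair : ∀ a ∈ S, ∀ b ∈ S, a ≠ x → b ≠ x → a ≠ b → (a - x) + (b - x) ≠ 0 := by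
    intro a ha b hb hax hbx hab h0
    refine hS x hx a ha b hb (Ne.symm hax) (Ne.symm hbx) hab ?_
    rw [← h0, ← sub_eq_zero, ← h3]
    abel
  have hpar : ∀ a ∈ S, ∀ b ∈ S, a ≠ x → b ≠ x → a ≠ b → ∀ c, (a - x) + (b - x) = c - x →
      S = {x, c, a, b} → ∃ m u v : V2, u ≠ 0 ∧ v ≠ 0 ∧ u ≠ v ∧ u ≠ -v ∧
        S = {m + u, m - u, m + v, m - v} := by
    intro a ha b hb hax hbx hab c hc hSc
    have h3a := add_add_self_eq_zero (a - x)
    have h3b := add_add_self_eq_zero (b - x)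
    have hc' : c = x + ((a - x) + (b - x)) := by rw [hc]; abel
    generalize hp : a - x = p at *
    generalize hq : b - x = q at *
    have ha' : a = x + p := by rw [← hp]; abel
    have hb' : b = x + q := by rw [← hq]; abel
    have hp0 : p ≠ 0 := by rw [← hp]; exact sub_ne_zero.2 hax
    have hq0 : q ≠ 0 := by rw [← hq]; exact sub_ne_zero.2 hbx
    have hpq : p ≠ q := by rw [← hp, ← hq]; exact fun h => hab (sub_left_injective h)
    have hpq' : p + q ≠ 0 := by rw [← hp, ← hq]; exact hpair a ha b hb hax hbx hab
    have hind : ∀ p q : V2, p ≠ 0 → q ≠ 0 → p ≠ q → p + q ≠ 0 →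
        p + q ≠ 0 ∧ p - q ≠ 0 ∧ p + q ≠ p - q ∧ p + q ≠ -(p - q) := by decide +kernel
    obtain ⟨i1, i2, i3, i4⟩ := hind p q hp0 hq0 hpq hpq'
    refine ⟨x - p - q, p + q, p - q, i1, i2, i3, i4, ?_⟩
    rw [hSc, hc', ha', hb']
    have e1 : x - p - q + (p + q) = x := by abel
    have e2 : x - p - q - (p + q) = x + (p + q) := by
      have h3 := add_add_self_eq_zero (p + q)
      rw [← sub_eq_zero, ← neg_eq_zero, ← h3]
      abel
    have e3 : x - p - q + (p - q) = x + q := by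
      rw [← sub_eq_zero, ← neg_eq_zero, ← h3b]
      abel
    have e4 : x - p - q - (p - q) = x + p := by
      rw [← sub_eq_zero, ← neg_eq_zero, ← h3a]
      abel
    rw [e1, e2, e3, e4, Finset.pair_comm (x + p)]
  have hyzt : (y - x) + (z - x) + (t - x) ≠ 0 := by
    intro h0
    refine hS y hyx.2 z hzx.2 t htx.2 hyz hyt hzt ?_
    rw [← h0, ← sub_eq_zero, ← h3]
    abel
  rcases key (y - x) (z - x) (t - x) ⟨sub_ne_zero.2 hyx.1, sub_ne_zero.2 hzx.1,
    sub_ne_zero.2 htx.1, fun h => hyz (sub_left_injective h),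
    fun h => hyt (sub_left_injective h), fun h => hzt (sub_left_injective h),
    hpair y hyx.2 z hzx.2 hyx.1 hzx.1 hyz, hpair y hyx.2 t htx.2 hyx.1 htx.1 hyt,
    hpair z hzx.2 t htx.2 hzx.1 htx.1 hzt, hyzt⟩ with h' | h' | h'
  · exact hpar y hyx.2 z hzx.2 hyx.1 hzx.1 hyz t h' (by rw [hSx]; ext w; simp; tauto)
  · exact hpar y hyx.2 t htx.2 hyx.1 htx.1 hyt z h' (by rw [hSx]; ext w; simp; tauto)
  · exact hpar z hzx.2 t htx.2 hzx.1 htx.1 hzt y h' (by rw [hSx])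

/-- The cap of the four unit vectors in the plane. -/
def unitCap : Finset V2 := {(1, 0), -(1, 0), (0, 1), -(0, 1)}

theorem exists_hom_of_independent {u v : V2} (hu : u ≠ 0) (hv : v ≠ 0) (huv : u ≠ v)
    (huv' : u ≠ -v) : ∃ f : V2 →+ V2, Function.Injective f ∧ f u = (1, 0) ∧ f v = (0, 1) := by
  have hδ : ∀ u v : V2, u ≠ 0 → v ≠ 0 → u ≠ v → u ≠ -v →
      (u.1 * v.2 - u.2 * v.1) * (u.1 * v.2 - u.2 * v.1) = 1 := by decide +kernel
  specialize hδ u v hu hv huv huv'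
  generalize hd : u.1 * v.2 - u.2 * v.1 = δ at hδ
  let f : V2 →+ V2 :=
    { toFun := fun x => (δ * (v.2 * x.1 - v.1 * x.2), δ * (u.1 * x.2 - u.2 * x.1))
      map_zero' := by simp
      map_add' := fun x y => by
        refine Prod.ext ?_ ?_
        · simp only [Prod.fst_add, Prod.snd_add]
          ring
        · simp only [Prod.fst_add, Prod.snd_add]
          ring }
  refine ⟨f, fun x y hxy => ?_, Prod.ext ?_ ?_, Prod.ext ?_ ?_⟩
  · have h1 : δ * (v.2 * x.1 - v.1 * x.2) = δ * (v.2 * y.1 - v.1 * y.2) := congrArg Prod.fst hxy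
    have h2 : δ * (u.1 * x.2 - u.2 * x.1) = δ * (u.1 * y.2 - u.2 * y.1) := congrArg Prod.snd hxy
    refine Prod.ext ?_ ?_
    · linear_combination u.1 * h1 + v.1 * h2 - (x.1 - y.1) * hδ - δ * (x.1 - y.1) * hd
    · linear_combination u.2 * h1 + v.2 * h2 - (x.2 - y.2) * hδ - δ * (x.2 - y.2) * hd
  · change δ * (v.2 * u.1 - v.1 * u.2) = 1
    linear_combination hδ + δ * hd
  · change δ * (u.1 * u.2 - u.2 * u.1) = 0
    ring
  · change δ * (v.2 * v.1 - v.1 * v.2) = 0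
    ring
  · change δ * (u.1 * v.2 - u.2 * v.1) = 1
    linear_combination hδ + δ * hd

theorem IsSumFreeCap.isAffineImage_unitCap {S : Finset V2} (hS : IsSumFreeCap S)
    (h : S.card = 4) : IsAffineImage S unitCap := by
  obtain ⟨m, u, v, hu, hv, huv, huv', rfl⟩ := hS.exists_parallelogram h
  obtain ⟨f, hf, hfu, hfv⟩ := exists_hom_of_independent hu hv huv huv'
  refine ⟨f, -f m, hf, ?_⟩
  simp only [Finset.image_insert, Finset.image_singleton, map_add, map_sub, hfu, hfv, unitCap]
  congr 1
  · abel
  congr 1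
  · abel
  congr 1
  · abel
  · congr 1
    abel

end SmallCaps

section Triples

variable {G H : Type*} [AddCommGroup G] [AddCommGroup H] {A B C : Finset G}

theorem IsSumFreeTriple.mono {A' : Finset G} (h : IsSumFreeTriple A B C) (hA : A' ⊆ A) :
    IsSumFreeTriple A' B C :=
  fun a ha => h a (hA ha)

variable [DecidableEq H]

theorem IsSumFreeTriple.image {f : G →+ H} (hf : Function.Injective f) {t u v : H}
    (huv : t + u + v = 0) (h : IsSumFreeTriple A B C) :
    IsSumFreeTriple (A.image fun x => f x + t) (B.image fun x => f x + u)
      (C.image fun x => f x + v) := by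
  simp only [IsSumFreeTriple, Finset.forall_mem_image]
  intro a ha b hb c hc h0
  refine h a ha b hb c hc (hf ?_)
  rw [map_add, map_add, map_zero, ← h0]
  rw [← add_zero (f a + f b + f c), ← huv]
  abel

theorem IsSumFreeTriple.exists_image {A' : Finset H} (h : IsSumFreeTriple A B C)
    (hA : IsAffineImage A A') :
    ∃ B' C' : Finset H, IsAffineImage B B' ∧ IsAffineImage C C' ∧ IsSumFreeTriple A' B' C' := by
  obtain ⟨f, t, hf, rfl⟩ := hA
  exact ⟨_, _, ⟨f, 0, hf, rfl⟩, ⟨f, -t, hf, rfl⟩, h.image hf (by abel)⟩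

end Triples

section NormalForms

theorem exists_isAffineImage_of_slices {W : Type*} [AddCommGroup W] [Fintype W] [DecidableEq W]
    [Module (ZMod 3) W] (S : Finset (W × ZMod 3)) (f : W →+ W)
    (hf : Function.Injective f) {t u v : W} (h : t + u + v = 0) :
    ∃ S' : Finset (W × ZMod 3), IsAffineImage S S' ∧
      (slice S' 0 = (slice S 0).image fun w => f w + t) ∧
      (slice S' 1 = (slice S 1).image fun w => f w + u) ∧
      slice S' 2 = (slice S 2).image fun w => f w + v := by
  obtain ⟨S', hS, hs⟩ := exists_isAffineImage_slice S f hf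
    (fun i => if i = 0 then t else if i = 1 then u else v) h
  exact ⟨S', hS, hs 0, hs 1, hs 2⟩

/-- The elliptic paraboloid, a cap with nine points. -/
def paraboloid : Finset V3 :=
  Finset.univ.filter fun v => v.1.1 * v.1.1 + v.1.2 * v.1.2 = v.2

theorem card_paraboloid : paraboloid.card = 9 := by
  decide +kernel

theorem slice_zero_paraboloid : slice paraboloid 0 = {0} := by
  decide +kernel

theorem slice_one_paraboloid : slice paraboloid 1 = unitCap := by
  decide +kernel

theorem subset_of_slices {W : Type*} [AddCommGroup W] [Fintype W] [DecidableEq W]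
    {S T : Finset (W × ZMod 3)} (h0 : slice S 0 ⊆ slice T 0) (h1 : slice S 1 ⊆ slice T 1)
    (h2 : slice S 2 ⊆ slice T 2) : S ⊆ T := by
  rintro ⟨w, i⟩ hw
  have hi : ∀ i : ZMod 3, i = 0 ∨ i = 1 ∨ i = 2 := by decide
  rcases hi i with rfl | rfl | rfl
  · exact mem_slice.1 (h0 (mem_slice.2 hw))
  · exact mem_slice.1 (h1 (mem_slice.2 hw))
  · exact mem_slice.1 (h2 (mem_slice.2 hw))

/-- Every cap with nine points is an elliptic paraboloid. -/
theorem IsSumFreeCap.isAffineImage_paraboloid {S : Finset V3} (hS : IsSumFreeCap S)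
    (h : S.card = 9) : IsAffineImage S paraboloid := by
  have key : ∀ B ∈ Finset.powersetCard 4 (Finset.univ.filter fun w : V2 => -w ∉ unitCap),
      0 ∈ B → ∃ w ∈ B, w ≠ 0 ∧ -w ∈ B := by
    decide +kernel
  obtain ⟨T, hST, hT, c0, c1, c2⟩ := hS.exists_slices_of_card_eq_nine h
  obtain ⟨a, ha⟩ := Finset.card_eq_one.1 c0
  obtain ⟨f, t, hf, ht⟩ := (hT.isSumFreeCap_slice 1).isAffineImage_unitCap c1
  obtain ⟨T', hTT', h0, h1, h2⟩ := exists_isAffineImage_of_slices T f hf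
    (show -f a + t + (f a - t) = 0 by abel)
  have hT' := hTT'.isSumFreeCap hT
  rw [ha, Finset.image_singleton, add_neg_cancel] at h0
  rw [← ht] at h1
  have c2' : (slice T' 2).card = 4 := by
    rw [h2, ← c2]
    exact IsAffineImage.card_eq ⟨f, _, hf, rfl⟩
  have htri := hT'.isSumFreeTriple_slice (i := 0) (j := 1) (k := 2) (by decide) (by decide)
    (by decide)
  rw [h0, h1] at htri
  have hB : ∀ w ∈ slice T' 2, -w ∉ unitCap := fun w hw hw' =>
    htri 0 (by simp) _ hw' w hw (by simp)
  have hB0 : (0 : V2) ∉ slice T' 2 := by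
    intro hz
    obtain ⟨w, hw, hw0, hnw⟩ := key _ (Finset.mem_powersetCard.2
      ⟨fun w hw => Finset.mem_filter.2 ⟨Finset.mem_univ _, hB w hw⟩, c2'⟩) hz
    refine hT'.isSumFreeCap_slice 2 0 hz w hw (-w) hnw hw0.symm ?_ ?_ (by simp)
    · exact (neg_ne_zero.2 hw0).symm
    · have : ∀ w : V2, w ≠ 0 → w ≠ -w := by decide +kernel
      exact this w hw0
  have hB2 : ∀ w : V2, -w ∉ unitCap → w ≠ 0 → w ∈ slice paraboloid 2 := by decide +kernel
  have hsub : T' ⊆ paraboloid := subset_of_slices (by rw [h0, slice_zero_paraboloid])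
    (by rw [h1, slice_one_paraboloid]) fun w hw => hB2 w (hB w hw) fun h0 => hB0 (h0 ▸ hw)
  rw [← Finset.eq_of_subset_of_card_le hsub
    (by rw [card_paraboloid, hTT'.card_eq, hST.card_eq, h])]
  exact hST.trans hTT'

/-- Eight points forming two parallelograms in parallel planes. -/
def doubleParallelogram (u v : V2) : Finset V3 :=
  unitCap.image (·, 1) ∪ {(u, 2), (-u, 2), (v, 2), (-v, 2)}

theorem IsSumFreeCap.isAffineImage_doubleParallelogram {S : Finset V3} (hS : IsSumFreeCap S)
    (h : S.card = 8) : ∃ u v : V2, u ≠ 0 ∧ v ≠ 0 ∧ u ≠ v ∧ u ≠ -v ∧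
      IsAffineImage S (doubleParallelogram u v) := by
  obtain ⟨T, hST, hT, c0, c1, c2⟩ := hS.exists_slices_of_card_eq_eight h
  obtain ⟨f, t, hf, ht⟩ := (hT.isSumFreeCap_slice 1).isAffineImage_unitCap c1
  have hB : IsAffineImage (slice T 2) ((slice T 2).image f) := IsAffineImage.of_hom f hf _
  obtain ⟨m, u, v, hu, hv, huv, huv', hm⟩ :=
    (hB.isSumFreeCap (hT.isSumFreeCap_slice 2)).exists_parallelogram (hB.card_eq.trans c2)
  obtain ⟨T', hTT', h0, h1, h2⟩ := exists_isAffineImage_of_slices T f hf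
    (show m - t + t + -m = 0 by abel)
  refine ⟨u, v, hu, hv, huv, huv', ?_⟩
  rw [Finset.card_eq_zero.1 c0, Finset.image_empty] at h0
  rw [← ht] at h1
  have h2' : slice T' 2 = {u, -u, v, -v} := by
    rw [h2, show (fun w => f w + -m) = (fun w => w + -m) ∘ f from rfl, ← Finset.image_image, hm]
    simp only [Finset.image_insert, Finset.image_singleton]
    congr 1
    · abel
    congr 1
    · abel
    congr 1
    · abel
    · congr 1
      abel
  have : T' = doubleParallelogram u v := by
    refine Finset.eq_of_subset_of_card_le (subset_of_slices ?_ ?_ ?_) ?_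
    · simp [h0]
    · rw [h1]
      intro w hw
      rw [mem_slice, doubleParallelogram, Finset.mem_union]
      exact Or.inl (Finset.mem_image_of_mem _ hw)
    · rw [h2']
      intro w hw
      rw [mem_slice, doubleParallelogram, Finset.mem_union]
      simpa using Or.inr hw
    · rw [hTT'.card_eq, hST.card_eq, h]
      refine (Finset.card_union_le _ _).trans ?_
      exact add_le_add (Finset.card_image_le.trans (by decide)) Finset.card_le_four
  rw [← this]
  exact hST.trans hTT'

theorem IsSumFreeTriple.card_le_of_isAffineImage {A A' B C : Finset V3} (hA : IsAffineImage A A')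
    (hB : IsSumFreeCap B) (hC : IsSumFreeCap C) (h : IsSumFreeTriple A B C) {l : List ℕ}
    (hl : ∀ a ∈ l, a ∈ A'.image code) {m k : ℕ} (hs : pairSearch l m k = true)
    (hk : k < C.card) : B.card ≤ m := by
  obtain ⟨B', C', hBB', hCC', h'⟩ := h.exists_image hA
  rw [← hBB'.card_eq]
  exact card_le_of_pairSearch_of_lt_card (hBB'.isSumFreeCap hB) (hCC'.isSumFreeCap hC) h' hl hs
    (by rwa [hCC'.card_eq])

theorem IsSumFreeTriple.card_le_seven {A B C : Finset V3} (hA : IsSumFreeCap A)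
    (hB : IsSumFreeCap B) (hC : IsSumFreeCap C) (h : IsSumFreeTriple A B C)
    (hA8 : A.card = 8) (hC3 : 2 < C.card) : B.card ≤ 7 := by
  have hmem : ∀ u v : V2, u ≠ 0 ∧ v ≠ 0 ∧ u ≠ v ∧ u ≠ -v →
      ∃ l ∈ [[51, 52, 55, 60], [51, 52, 56, 62], [51, 52, 57, 61], [55, 60, 56, 62],
        [55, 60, 57, 61], [56, 62, 57, 61]],
        ∀ a ∈ [26, 27, 30, 35] ++ l, a ∈ (doubleParallelogram u v).image code := by
    decide +kernel
  have hsearch : ∀ l ∈ [[51, 52, 55, 60], [51, 52, 56, 62], [51, 52, 57, 61], [55, 60, 56, 62],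
      [55, 60, 57, 61], [56, 62, 57, 61]], pairSearch ([26, 27, 30, 35] ++ l) 7 2 = true := by
    decide +kernel
  obtain ⟨u, v, hu, hv, huv, huv', hAA'⟩ := hA.isAffineImage_doubleParallelogram hA8
  obtain ⟨l, hl, hl'⟩ := hmem u v ⟨hu, hv, huv, huv'⟩
  exact h.card_le_of_isAffineImage hAA' hB hC hl' (hsearch l hl) hC3

end NormalForms

section Quadric

/-- The codes of the points of the paraboloid other than the origin. -/
def puncturedParaboloidCodes : List ℕ :=
  [26, 27, 30, 35, 56, 57, 61, 62]

theorem mem_image_code_paraboloid :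
    ∀ a ∈ 0 :: puncturedParaboloidCodes, a ∈ paraboloid.image code := by
  decide +kernel

theorem mem_image_code_paraboloid_erase :
    ∀ a ∈ puncturedParaboloidCodes, a ∈ (paraboloid.erase 0).image code := by
  decide +kernel

/-- The bound for a cap whose sums with a cap of size `n` avoid a paraboloid. -/
def paraboloidBound (n : ℕ) : ℕ :=
  bif n.ble 2 then 9 else bif n.ble 3 then 6 else bif n.ble 4 then 5 else 4

/-- The bound for a cap whose sums with a cap of size `n` avoid a punctured paraboloid. -/
def puncturedParaboloidBound (n : ℕ) : ℕ :=
  bif n.ble 2 then 9 else bif n.ble 3 then 7 else bif n.ble 4 then 6 else 5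

theorem IsSumFreeTriple.card_le_paraboloidBound {B C : Finset V3} (hB : IsSumFreeCap B)
    (hC : IsSumFreeCap C) (h : IsSumFreeTriple paraboloid B C) :
    B.card ≤ paraboloidBound C.card := by
  have h1 : pairSearch (0 :: puncturedParaboloidCodes) 6 2 = true := by decide +kernel
  have h2 : pairSearch (0 :: puncturedParaboloidCodes) 5 3 = true := by decide +kernel
  have h3 : pairSearch (0 :: puncturedParaboloidCodes) 4 4 = true := by decide +kernel
  have key := fun {m k : ℕ} => card_le_of_pairSearch_of_lt_card (m := m) (k := k) hB hC h
    mem_image_code_paraboloid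
  unfold paraboloidBound
  simp only [Bool.cond_eq_ite, Nat.ble_eq]
  split_ifs
  · exact hB.card_le_nine
  · exact key h1 (by omega)
  · exact key h2 (by omega)
  · exact key h3 (by omega)

theorem IsSumFreeTriple.card_le_puncturedParaboloidBound {B C : Finset V3} (hB : IsSumFreeCap B)
    (hC : IsSumFreeCap C) (h : IsSumFreeTriple (paraboloid.erase 0) B C) :
    B.card ≤ puncturedParaboloidBound C.card := by
  have h1 : pairSearch puncturedParaboloidCodes 7 2 = true := by decide +kernel
  have h2 : pairSearch puncturedParaboloidCodes 6 3 = true := by decide +kernel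
  have h3 : pairSearch puncturedParaboloidCodes 5 4 = true := by decide +kernel
  have key := fun {m k : ℕ} => card_le_of_pairSearch_of_lt_card (m := m) (k := k) hB hC h
    mem_image_code_paraboloid_erase
  unfold puncturedParaboloidBound
  simp only [Bool.cond_eq_ite, Nat.ble_eq]
  split_ifs
  · exact hB.card_le_nine
  · exact key h1 (by omega)
  · exact key h2 (by omega)
  · exact key h3 (by omega)

/-- The quadratic form with Witt index one in four variables. -/
def quadraticForm (v : V4) : ZMod 3 :=
  v.2 * v.1.2 - v.1.1.1 * v.1.1.1 - v.1.1.2 * v.1.1.2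

/-- The cone of nonzero isotropic vectors, a cap with twenty points. -/
def quadric : Finset V4 :=
  Finset.univ.filter fun v => quadraticForm v = 0 ∧ v ≠ 0

theorem card_quadric : quadric.card = 20 := by
  decide +kernel

/-- The isotropic vector fixed by the shears preserving the paraboloid. -/
abbrev axis : V3 := ((0, 0), 1)

theorem axis_mem_quadric : axis ∈ slice quadric 0 := by
  decide +kernel

theorem neg_axis_mem_quadric : -axis ∈ slice quadric 0 := by
  decide +kernel

theorem slice_one_quadric : slice quadric 1 = paraboloid := by
  decide +kernel

theorem mem_slice_two_quadric (w : V3) : w ∈ slice quadric 2 ↔ -w ∈ paraboloid := by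
  revert w
  decide +kernel

theorem mem_paraboloid_or (w : V3) :
    -w ∈ paraboloid ∨ -w - axis ∈ paraboloid ∨ -w + axis ∈ paraboloid := by
  revert w
  decide +kernel

/-- The codes of the points `w` for which `w` and `axis` have no sum zero with the paraboloid. -/
def axisCodes : List ℕ :=
  points.filter fun x => !(bit (blocked 25 (0 :: puncturedParaboloidCodes)) x)

theorem code_mem_axisCodes (w : V3) (hw : -w - axis ∉ paraboloid) : code w ∈ axisCodes := by
  revert w
  decide +kernel

theorem eq_of_card_pair {B C : Finset V3} (hB : IsSumFreeCap B) (hC : IsSumFreeCap C)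
    (h : IsSumFreeTriple paraboloid B C) (hB8 : 8 ≤ B.card) {c : V3} (hCc : C = {axis, c})
    (hc : axis ≠ c) : c = 0 ∨ c = -axis := by
  by_contra! hne
  have hs : noPair (0 :: puncturedParaboloidCodes) 7 1 [25]
      (((points.erase 25).erase 0).erase 50) axisCodes = true := by decide +kernel
  have hmem : ∀ c : V3, axis ≠ c → c ≠ 0 ∧ c ≠ -axis →
      code c ∈ ((points.erase 25).erase 0).erase 50 := by decide +kernel
  have := card_le_of_noPair hB hC h mem_image_code_paraboloid hs
    (fun q hq => by
      rw [List.mem_singleton.1 hq]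
      exact Finset.mem_image.2 ⟨axis, by simp [hCc], rfl⟩) (by decide) ?_
      (by rw [hCc, Finset.card_pair hc]; rfl)
    (by decide +kernel) fun w hw => code_mem_axisCodes w fun hw' =>
      h _ hw' w hw axis (by simp [hCc]) (by abel)
  · omega
  · intro w hw
    rw [hCc, Finset.mem_insert, Finset.mem_singleton] at hw
    rcases hw with rfl | rfl
    · decide
    · exact List.mem_append_right _ (hmem w hc hne)

theorem forall_mem_or_forall_mem {B : Finset V3} (hB : IsSumFreeCap B) (hB9 : B.card = 9)
    (h : ∀ w ∈ B, -w - axis ∉ paraboloid) :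
    (∀ w ∈ B, -w ∈ paraboloid) ∨ ∀ w ∈ B, -w + axis ∈ paraboloid := by
  by_contra! hne
  obtain ⟨⟨x, hx, hx'⟩, y, hy, hy'⟩ := hne
  have hs : ∀ a ∈ axisCodes.filter fun a => decide (third 0 a ∉ 0 :: puncturedParaboloidCodes),
      ∀ b ∈ axisCodes.filter fun b => decide (third 0 b ∈ 0 :: puncturedParaboloidCodes),
        noCap 7 [a, b] (((axisCodes.erase a).erase b).erase (third a b)) = true := by
    decide +kernel
  have hcode : ∀ w : V3, (third 0 (code w) ∈ 0 :: puncturedParaboloidCodes) ↔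
      -w ∈ paraboloid := by decide +kernel
  have hnodup : axisCodes.Nodup := by decide +kernel
  have hy'' : -y ∈ paraboloid := by
    rcases mem_paraboloid_or y with hw | hw | hw
    · exact hw
    · exact absurd hw (h y hy)
    · exact absurd hw hy'
  have hxy : x ≠ y := fun hxy => hx' (hxy ▸ hy'')
  have hx0 := code_mem_axisCodes x (h x hx)
  have hy0 := code_mem_axisCodes y (h y hy)
  have hnotMem := hB.isCodedCap _ (Finset.mem_image_of_mem code hx) _
    (Finset.mem_image_of_mem code hy) (code_injective.ne hxy)
  have := card_lt_of_noCap hB (hs _ (List.mem_filter.2 ⟨hx0, by simpa [hcode] using hx'⟩)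
    _ (List.mem_filter.2 ⟨hy0, by simpa [hcode] using hy''⟩)) ?_ ?_ ?_
  · rw [hB9] at this
    exact lt_irrefl _ this
  · intro q hq
    rw [List.mem_cons, List.mem_singleton] at hq
    rcases hq with rfl | rfl
    · exact Finset.mem_image_of_mem code hx
    · exact Finset.mem_image_of_mem code hy
  · have hne := code_injective.ne hxy
    have h2 := (hnodup.erase (code x)).erase (code y)
    rw [List.cons_append, List.cons_append, List.nil_append, List.nodup_cons, List.nodup_cons]
    refine ⟨?_, fun hmem => ?_, h2.erase _⟩
    · rw [List.mem_cons, not_or]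
      exact ⟨hne, fun hmem => hnodup.not_mem_erase
        (List.mem_of_mem_erase (List.mem_of_mem_erase hmem))⟩
    · exact (hnodup.erase _).not_mem_erase (List.mem_of_mem_erase hmem)
  · intro v hv
    rw [List.cons_append, List.cons_append, List.nil_append, List.mem_cons, List.mem_cons]
    by_cases hvx : code v = code x
    · exact Or.inl hvx
    by_cases hvy : code v = code y
    · exact Or.inr (Or.inl hvy)
    refine Or.inr (Or.inr ?_)
    rw [List.mem_erase_of_ne, List.mem_erase_of_ne hvy, List.mem_erase_of_ne hvx]
    · exact code_mem_axisCodes v (h v hv)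
    · exact fun heq => hnotMem (heq ▸ Finset.mem_image_of_mem code hv)

/-- Caps with nineteen points are contained in the quadric, up to an affine map. -/
theorem IsSumFreeCap.exists_isAffineImage_subset_quadric_of_card_eq {S : Finset V4}
    (hS : IsSumFreeCap S) (h : S.card = 19) : ∃ T, IsAffineImage S T ∧ T ⊆ quadric := by
  obtain ⟨T, hST, hT, hcard⟩ := hS.exists_slices_of_card_eq_nineteen h
  have htri := hT.isSumFreeTriple_slice (i := 1) (j := 2) (k := 0) (by decide) (by decide)
    (by decide)
  obtain ⟨c0, c0', c1, c2⟩ : 0 < (slice T 0).card ∧ (slice T 0).card ≤ 2 ∧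
      (slice T 1).card = 9 ∧ ((slice T 0).card = 1 ∧ (slice T 2).card = 9 ∨
        (slice T 0).card = 2 ∧ 8 ≤ (slice T 2).card) := by
    rcases hcard with ⟨a0, a1, a2⟩ | ⟨a0, a1, a2⟩ | ⟨a0, a1, a2⟩
    · omega
    · omega
    · have := htri.card_le_seven (hT.isSumFreeCap_slice 1) (hT.isSumFreeCap_slice 2)
        (hT.isSumFreeCap_slice 0) a1 (by omega)
      omega
  obtain ⟨a, ha⟩ := Finset.card_pos.1 c0
  obtain ⟨f, t, hf, ht⟩ := (hT.isSumFreeCap_slice 1).isAffineImage_paraboloid c1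
  obtain ⟨U, hTU, h0, h1, h2⟩ := exists_isAffineImage_of_slices T f hf
    (show axis - f a + t + (f a - axis - t) = 0 by abel)
  have hU := hTU.isSumFreeCap hT
  rw [← ht] at h1
  have e0 : (slice U 0).card = (slice T 0).card := by
    rw [h0]
    exact IsAffineImage.card_eq ⟨f, _, hf, rfl⟩
  have e2 : (slice U 2).card = (slice T 2).card := by
    rw [h2]
    exact IsAffineImage.card_eq ⟨f, _, hf, rfl⟩
  have haU : axis ∈ slice U 0 := by
    rw [h0]
    exact Finset.mem_image.2 ⟨a, ha, by abel⟩
  rw [← e0, ← e2] at c2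
  have htriU := hU.isSumFreeTriple_slice (i := 1) (j := 2) (k := 0) (by decide) (by decide)
    (by decide)
  rw [h1] at htriU
  have hB := hU.isSumFreeCap_slice 2
  have hSU := hST.trans hTU
  have haxis : ∀ w ∈ slice U 2, -w - axis ∉ paraboloid := fun w hw hw' =>
    htriU _ hw' w hw axis haU (by abel)
  have hmain : (slice U 0 ⊆ slice quadric 0 ∧ ∀ w ∈ slice U 2, -w ∈ paraboloid) ∨
      ((slice U 0).image (fun w => w + axis) ⊆ slice quadric 0 ∧
        ∀ w ∈ slice U 2, -w + axis ∈ paraboloid) := by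
    have h2axis : axis + axis = -axis := by decide
    rcases c2 with ⟨d0, d2⟩ | ⟨d0, d2⟩
    · obtain ⟨b, hb⟩ := Finset.card_eq_one.1 d0
      rw [hb, Finset.mem_singleton] at haU
      rw [hb, ← haU]
      refine (forall_mem_or_forall_mem hB d2 haxis).imp (fun h => ⟨?_, h⟩) fun h => ⟨?_, h⟩
      · simpa using axis_mem_quadric
      · rw [Finset.image_singleton, Finset.singleton_subset_iff, h2axis]
        exact neg_axis_mem_quadric
    · obtain ⟨c, hc⟩ := Finset.card_eq_one.1
        (show ((slice U 0).erase axis).card = 1 by rw [Finset.card_erase_of_mem haU, d0])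
      have hc' : slice U 0 = {axis, c} := by rw [← Finset.insert_erase haU, hc]
      have hne : axis ≠ c := by
        rintro rfl
        rw [hc', Finset.pair_eq_singleton, Finset.card_singleton] at d0
        omega
      have hcU : c ∈ slice U 0 := by simp [hc']
      rw [hc']
      rcases eq_of_card_pair hB (hU.isSumFreeCap_slice 0) htriU d2 hc' hne with rfl | rfl
      · refine Or.inr ⟨?_, fun w hw => ?_⟩
        · simp only [Finset.image_insert, Finset.image_singleton, h2axis, zero_add]
          decide +kernel
        · rcases mem_paraboloid_or w with hw' | hw' | hw'
          · exact absurd (show -w + w + 0 = 0 by abel) (htriU _ hw' w hw 0 hcU)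
          · exact absurd hw' (haxis w hw)
          · exact hw'
      · refine Or.inl ⟨by decide +kernel, fun w hw => ?_⟩
        rcases mem_paraboloid_or w with hw' | hw' | hw'
        · exact hw'
        · exact absurd hw' (haxis w hw)
        · exact absurd (show -w + axis + w + -axis = 0 by abel) (htriU _ hw' w hw _ hcU)
  rcases hmain with ⟨g0, g2⟩ | ⟨g0, g2⟩
  · exact ⟨U, hSU, subset_of_slices g0 (by rw [h1, slice_one_quadric]) fun w hw =>
      (mem_slice_two_quadric w).2 (g2 w hw)⟩
  · obtain ⟨X, hUX, k0, k1, k2⟩ := exists_isAffineImage_of_slices U (AddMonoidHom.id V3)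
      Function.injective_id (show axis + 0 + -axis = 0 by abel)
    refine ⟨X, hSU.trans hUX, subset_of_slices ?_ ?_ ?_⟩
    · rw [k0]
      exact g0
    · rw [k1, h1, slice_one_quadric]
      simp
    · rw [k2]
      intro w hw
      obtain ⟨x, hx, rfl⟩ := Finset.mem_image.1 hw
      rw [mem_slice_two_quadric, AddMonoidHom.id_apply, neg_add, neg_neg]
      exact g2 x hx

/-- Large caps in dimension four are contained in the quadric, up to an affine map. -/
theorem IsSumFreeCap.exists_isAffineImage_subset_quadric {S : Finset V4}
    (hS : IsSumFreeCap S) (h : 19 ≤ S.card) : ∃ T, IsAffineImage S T ∧ T ⊆ quadric := by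
  have key : ∀ y ∈ quadricᶜ, ∀ p ∈ quadric,
      ((quadric.erase p).filter fun k => -y - k ∈ quadric.erase p ∧ k ≠ -y - k).Nonempty := by
    decide +kernel
  obtain ⟨R, hRS, hR⟩ := Finset.exists_subset_card_eq h
  obtain ⟨T, ⟨f, t, hf, rfl⟩, hT⟩ :=
    (hS.subset hRS).exists_isAffineImage_subset_quadric_of_card_eq hR
  have hST : IsAffineImage S (S.image fun x => f x + t) := ⟨f, t, hf, rfl⟩
  have hcap := hST.isSumFreeCap hS
  have hcard : (R.image fun x => f x + t).card = 19 := by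
    rw [IsAffineImage.card_eq ⟨f, t, hf, rfl⟩, hR]
  refine ⟨_, hST, fun y hy => ?_⟩
  by_contra hyK
  obtain ⟨p, hp⟩ := Finset.card_eq_one.1
    (show (quadric \ R.image fun x => f x + t).card = 1 by
      rw [Finset.card_sdiff_of_subset hT, hcard, card_quadric])
  have hpK : p ∈ quadric := (Finset.mem_sdiff.1 (hp ▸ Finset.mem_singleton_self p)).1
  have hmem : ∀ k ∈ quadric, k ≠ p → k ∈ S.image fun x => f x + t := fun k hk hkp => by
    by_contra hk'
    refine hkp (Finset.mem_singleton.1 (hp ▸ Finset.mem_sdiff.2 ⟨hk, fun hkR => hk' ?_⟩))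
    exact Finset.image_subset_image hRS hkR
  obtain ⟨k, hk⟩ := key y (Finset.mem_compl.2 hyK) p hpK
  simp only [Finset.mem_filter, Finset.mem_erase] at hk
  obtain ⟨⟨hkp, hk⟩, ⟨hkp', hk'⟩, hne⟩ := hk
  exact hcap y hy k (hmem k hk hkp) _ (hmem _ hk' hkp') (fun h => hyK (h ▸ hk))
    (fun h => hyK (h ▸ hk')) hne (by abel)

theorem IsSumFreeCap.card_le_twenty {S : Finset V4} (hS : IsSumFreeCap S) : S.card ≤ 20 := by
  by_contra! h
  obtain ⟨T, hST, hT⟩ := hS.exists_isAffineImage_subset_quadric (by omega)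
  have := Finset.card_le_card hT
  rw [hST.card_eq, card_quadric] at this
  omega

end Quadric

section Isometries

/-- The polar form of the quadratic form. -/
def polarForm (v w : V4) : ZMod 3 :=
  v.2 * w.1.2 + v.1.2 * w.2 + v.1.1.1 * w.1.1.1 + v.1.1.2 * w.1.1.2

theorem polarForm_add_left (v w x : V4) : polarForm (v + w) x = polarForm v x + polarForm w x := by
  simp only [polarForm, Prod.fst_add, Prod.snd_add]
  ring

theorem quadraticForm_add (v w : V4) :
    quadraticForm (v + w) = quadraticForm v + quadraticForm w + polarForm v w := by
  have h : (3 : ZMod 3) = 0 := by decide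
  simp only [quadraticForm, polarForm, Prod.fst_add, Prod.snd_add]
  linear_combination -(v.1.1.1 * w.1.1.1 + v.1.1.2 * w.1.1.2) * h

theorem quadraticForm_sub_smul (v u : V4) (c : ZMod 3) :
    quadraticForm (v - c • u) =
      quadraticForm v - c * polarForm v u + c * c * quadraticForm u := by
  have h : (3 : ZMod 3) = 0 := by decide
  simp only [quadraticForm, polarForm, Prod.fst_sub, Prod.snd_sub, Prod.smul_fst, Prod.smul_snd,
    smul_eq_mul]
  linear_combination c * (v.1.1.1 * u.1.1.1 + v.1.1.2 * u.1.1.2) * h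

/-- The reflection in a vector, which is the identity for isotropic vectors. -/
def reflection (u : V4) : V4 →+ V4 where
  toFun v := v - (quadraticForm u * polarForm v u) • u
  map_zero' := by simp [polarForm]
  map_add' v w := by
    rw [polarForm_add_left, mul_add, add_smul]
    abel

theorem reflection_apply (u v : V4) :
    reflection u v = v - (quadraticForm u * polarForm v u) • u :=
  rfl

theorem quadraticForm_reflection (u v : V4) :
    quadraticForm (reflection u v) = quadraticForm v := by
  have h : ∀ x : ZMod 3, x * x * x = x := by decide
  rw [reflection_apply, quadraticForm_sub_smul]
  linear_combination polarForm v u * polarForm v u * h (quadraticForm u)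

theorem polarForm_self_right (v : V4) (h : ∀ w, polarForm v w = 0) : v = 0 := by
  have h1 := h (((0, 0), 0), 1)
  have h2 := h (((0, 0), 1), 0)
  have h3 := h (((1, 0), 0), 0)
  have h4 := h (((0, 1), 0), 0)
  simp only [polarForm, mul_zero, mul_one, zero_add, add_zero] at h1 h2 h3 h4
  exact Prod.ext (Prod.ext (Prod.ext h3 h4) h1) h2

/-- An additive map preserving the quadratic form. -/
def IsIsometry (f : V4 →+ V4) : Prop :=
  ∀ v, quadraticForm (f v) = quadraticForm v

namespace IsIsometry

variable {f g : V4 →+ V4}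

theorem comp (hf : IsIsometry f) (hg : IsIsometry g) : IsIsometry (f.comp g) :=
  fun v => (hf _).trans (hg v)

theorem polarForm_map (hf : IsIsometry f) (v w : V4) :
    polarForm (f v) (f w) = polarForm v w := by
  have h := quadraticForm_add (f v) (f w)
  rw [← map_add, hf, hf, hf, quadraticForm_add] at h
  exact (add_left_cancel h).symm

theorem injective (hf : IsIsometry f) : Function.Injective f := by
  refine (injective_iff_map_eq_zero f).2 fun v hv => polarForm_self_right v fun w => ?_
  rw [← hf.polarForm_map, hv]
  simp [polarForm]

end IsIsometry

theorem isIsometry_reflection (u : V4) : IsIsometry (reflection u) :=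
  quadraticForm_reflection u

/-- The point of the quadric whose polar hyperplane is the zero slice. -/
abbrev apex : V4 := (axis, 0)

/-- The vertex of the paraboloid as a point of the quadric. -/
abbrev vertex : V4 := (0, 1)

/-- A vector whose reflection moves `v` to the vertex up to sign, unless `v` lies in the zero
slice. -/
def vertexMirror (v : V4) : V4 :=
  if v.2 = 1 then v - vertex else if v.2 = 2 then v + vertex else 0

/-- Any two isotropic vectors can be moved to standard position. -/
theorem exists_isIsometry {d p : V4} (hd : d ∈ quadric) (hp : p ∈ quadric) :
    ∃ f : V4 →+ V4, IsIsometry f ∧ (f d = apex ∨ f d = -apex) ∧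
      (f p = vertex ∨ f p = apex ∨ f p = -apex) := by
  have hneg : IsIsometry (-AddMonoidHom.id V4) := fun v => by
    simp [quadraticForm]
  have key : ∀ d ∈ quadric, ∀ p ∈ quadric,
      (reflection (vertexMirror (reflection (d - apex) p)) (reflection (d - apex) d) = apex ∨
        reflection (vertexMirror (reflection (d - apex) p)) (reflection (d - apex) d) = -apex) ∧
      reflection (vertexMirror (reflection (d - apex) p)) (reflection (d - apex) p) ∈
        ({vertex, -vertex, apex, -apex} : Finset V4) := by
    decide +kernel
  obtain ⟨h1, h2⟩ := key d hd p hp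
  simp only [Finset.mem_insert, Finset.mem_singleton] at h2
  have hf := (isIsometry_reflection (vertexMirror (reflection (d - apex) p))).comp
    (isIsometry_reflection (d - apex))
  rcases h2 with h2 | h2 | h2
  · exact ⟨_, hf, h1, Or.inl h2⟩
  · refine ⟨_, hneg.comp hf, ?_, Or.inl (neg_eq_iff_eq_neg.2 h2)⟩
    exact h1.symm.imp neg_eq_iff_eq_neg.2 (congrArg Neg.neg)
  · exact ⟨_, hf, h1, Or.inr h2⟩

theorem card_filter_polarForm_ge (w : V4) :
    8 ≤ (quadric.filter fun d => polarForm d w = 0).card + if w ∈ quadric then 6 else 0 := by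
  have key : ∀ w ∈ (Finset.univ : Finset V4),
      8 ≤ (quadric.filter fun d => polarForm d w = 0).card + if w ∈ quadric then 6 else 0 := by
    decide +kernel
  exact key w (Finset.mem_univ w)

end Isometries

section DoubleCounting

theorem card_filter_add_snd_eq {W : Type*} [AddCommGroup W] [Fintype W] [DecidableEq W]
    (B C : Finset (W × ZMod 3)) :
    ((B ×ˢ C).filter fun x => (x.1 + x.2).2 = 0).card =
      (slice B 0).card * (slice C 0).card + (slice B 1).card * (slice C 2).card +
        (slice B 2).card * (slice C 1).card := by
  have h : ∀ i : ZMod 3, (((B ×ˢ C).filter fun x => (x.1 + x.2).2 = 0).filter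
      fun x => x.1.2 = i).card = (slice B i).card * (slice C (-i)).card := by
    intro i
    rw [card_slice, card_slice, ← Finset.card_product]
    congr 1
    ext ⟨x, y⟩
    simp only [Finset.mem_filter, Finset.mem_product, Prod.snd_add]
    constructor
    · rintro ⟨⟨⟨hx, hy⟩, h⟩, rfl⟩
      exact ⟨⟨hx, rfl⟩, hy, (neg_eq_of_add_eq_zero_right h).symm⟩
    · rintro ⟨⟨hx, rfl⟩, hy, h⟩
      exact ⟨⟨⟨hx, hy⟩, by rw [h, add_neg_cancel]⟩, rfl⟩
  rw [Finset.card_eq_sum_card_fiberwise (f := fun x => x.1.2) (t := Finset.univ)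
    fun _ _ => Finset.mem_coe.2 (Finset.mem_univ _), Finset.sum_congr rfl fun i _ => h i]
  exact Fin.sum_univ_three fun i : ZMod 3 => (slice B i).card * (slice C (-i)).card

theorem IsSumFreeTriple.slice {W : Type*} [AddCommGroup W] [Fintype W] [DecidableEq W]
    {A B C : Finset (W × ZMod 3)} (h : IsSumFreeTriple A B C) {i j k : ZMod 3}
    (hijk : i + j + k = 0) : IsSumFreeTriple (slice A i) (slice B j) (slice C k) :=
  fun _ ha _ hb _ hc h0 => h _ (mem_slice.1 ha) _ (mem_slice.1 hb) _ (mem_slice.1 hc)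
    (Prod.ext h0 hijk)

/-- The bounds `g` and `paraboloidBound` on slices imply the bound `M` on the number of pairs in
opposite slices, for a cap with `m` points and a cap with slices of sizes `c₀`, `c₁`, `c₂`. -/
def SliceProductBounded (g : ℕ → ℕ) (m M c₀ c₁ c₂ : ℕ) : Prop :=
  ∀ b₀ < 10, ∀ b₁ < 10,
    b₀ ≤ g c₂ ∧ b₀ ≤ paraboloidBound c₁ ∧ b₁ ≤ g c₁ ∧ b₁ ≤ paraboloidBound c₀ ∧
      m - b₀ - b₁ ≤ g c₀ ∧ m - b₀ - b₁ ≤ paraboloidBound c₂ →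
        b₀ * c₀ + b₁ * c₂ + (m - b₀ - b₁) * c₁ ≤ M

instance (g : ℕ → ℕ) (m M c₀ c₁ c₂ : ℕ) : Decidable (SliceProductBounded g m M c₀ c₁ c₂) := by
  unfold SliceProductBounded
  infer_instance

/-- The bounds `g` and `paraboloidBound` on slices imply the bound `M` on the number of pairs in
opposite slices, for caps with `m` and `n` points. -/
def SliceProductsBounded (g : ℕ → ℕ) (m n M : ℕ) : Prop :=
  ∀ c₀ < 10, ∀ c₁ < 10, ∀ c₂ < 10, c₀ + c₁ + c₂ = n → SliceProductBounded g m M c₀ c₁ c₂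

instance (g : ℕ → ℕ) (m n M : ℕ) : Decidable (SliceProductsBounded g m n M) := by
  unfold SliceProductsBounded
  infer_instance

theorem card_filter_add_snd_le {A B C : Finset V4} (hB : IsSumFreeCap B) (hC : IsSumFreeCap C)
    (h : IsSumFreeTriple A B C) (hA : ∀ w ∈ paraboloid, (-w, 2) ∈ A) {g : ℕ → ℕ}
    (hg : ∀ X Y : Finset V3, IsSumFreeCap X → IsSumFreeCap Y →
      IsSumFreeTriple (slice A 1) X Y → X.card ≤ g Y.card) {M : ℕ}
    (hM : SliceProductsBounded g B.card C.card M) :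
    ((B ×ˢ C).filter fun x => (x.1 + x.2).2 = 0).card ≤ M := by
  have h2 : ∀ X Y : Finset V3, IsSumFreeCap X → IsSumFreeCap Y →
      IsSumFreeTriple (slice A 2) X Y → X.card ≤ paraboloidBound Y.card := by
    intro X Y hX hY hXY
    obtain ⟨X', Y', hX', hY', hXY'⟩ := hXY.exists_image
      (IsAffineImage.of_hom (-AddMonoidHom.id V3) neg_injective (slice A 2))
    rw [← hX'.card_eq, ← hY'.card_eq]
    refine (hXY'.mono fun w hw => ?_).card_le_paraboloidBound (hX'.isSumFreeCap hX)
      (hY'.isSumFreeCap hY)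
    exact Finset.mem_image.2 ⟨-w, mem_slice.2 (hA w hw), neg_neg w⟩
  have hBs := hB.isSumFreeCap_slice
  have hCs := hC.isSumFreeCap_slice
  have hb := fun i => Nat.lt_succ_of_le (hBs i).card_le_nine
  have hc := fun i => Nat.lt_succ_of_le (hCs i).card_le_nine
  have hsum := card_slice_add B
  have hb2 : (slice B 2).card = B.card - (slice B 0).card - (slice B 1).card := by omega
  have e1 : ∀ j k : ZMod 3, 1 + j + k = 0 → (slice B j).card ≤ g (slice C k).card :=
    fun j k hjk => hg _ _ (hBs j) (hCs k) (h.slice hjk)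
  have e2 : ∀ j k : ZMod 3, 2 + j + k = 0 →
      (slice B j).card ≤ paraboloidBound (slice C k).card :=
    fun j k hjk => h2 _ _ (hBs j) (hCs k) (h.slice hjk)
  rw [card_filter_add_snd_eq, hb2]
  refine hM _ (hc 0) _ (hc 1) _ (hc 2) (card_slice_add C) _ (hb 0) _ (hb 1)
    ⟨e1 0 2 (by decide), e2 0 1 (by decide), e1 1 1 (by decide), e2 1 0 (by decide), ?_, ?_⟩
  · rw [← hb2]
    exact e1 2 0 (by decide)
  · rw [← hb2]
    exact e2 2 2 (by decide)

/-- The bound on the number of pairs orthogonal to an isotropic vector, for sum-free triples of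
caps the first of which is most of the quadric. -/
theorem card_filter_polarForm_le {A B C : Finset V4} (hB : IsSumFreeCap B) (hC : IsSumFreeCap C)
    (h : IsSumFreeTriple A B C) (hA : A ⊆ quadric) {d : V4} (hd : d ∈ quadric) {M : ℕ}
    (hM : A.card = 20 ∧ SliceProductsBounded paraboloidBound B.card C.card M ∨
      A.card = 19 ∧ SliceProductsBounded puncturedParaboloidBound B.card C.card M) :
    ((B ×ˢ C).filter fun x => polarForm d (x.1 + x.2) = 0).card ≤ M := by
  obtain ⟨p, hp, hAp⟩ : ∃ p ∈ quadric, ∀ x ∈ quadric, x ≠ p ∨ A.card = 20 → x ∈ A := by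
    have hsdiff := Finset.card_sdiff_of_subset hA
    rw [card_quadric] at hsdiff
    rcases hM with ⟨hA', -⟩ | ⟨hA', -⟩
    · rw [Finset.eq_of_subset_of_card_le hA (by rw [hA', card_quadric])]
      exact ⟨d, hd, fun x hx _ => hx⟩
    · rw [hA'] at hsdiff
      obtain ⟨p, hp⟩ := Finset.card_eq_one.1 hsdiff
      refine ⟨p, (Finset.mem_sdiff.1 (hp ▸ Finset.mem_singleton_self p)).1, fun x hx hxp => ?_⟩
      by_contra hxA
      refine hxp.elim (fun hne => hne ?_) (by omega)
      exact Finset.mem_singleton.1 (hp ▸ Finset.mem_sdiff.2 ⟨hx, hxA⟩)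
  obtain ⟨f, hf, hfd, hfp⟩ := exists_isIsometry hd hp
  have hfpolar : ∀ v, polarForm d v = 0 ↔ (f v).2 = 0 := by
    intro v
    rw [← hf.polarForm_map]
    rcases hfd with hfd | hfd <;> simp [hfd, polarForm]
  have hmem : ∀ x ∈ quadric, x ≠ f p ∨ A.card = 20 → x ∈ A.image f := by
    intro x hx hxp
    obtain ⟨y, rfl⟩ := Finite.injective_iff_surjective.1 hf.injective x
    refine Finset.mem_image_of_mem f (hAp y ?_ (hxp.imp_left fun hne heq => hne (by rw [heq])))
    rw [quadric, Finset.mem_filter, hf] at hx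
    rw [quadric, Finset.mem_filter]
    exact ⟨Finset.mem_univ _, hx.2.1, fun h0 => hx.2.2 (by rw [h0, map_zero])⟩
  have hBf := IsAffineImage.of_hom f hf.injective B
  have hCf := IsAffineImage.of_hom f hf.injective C
  have hcard : ((B ×ˢ C).filter fun x => polarForm d (x.1 + x.2) = 0).card =
      ((B.image f ×ˢ C.image f).filter fun x => (x.1 + x.2).2 = 0).card := by
    rw [← Finset.prodMap_image_product, Finset.filter_image,
      Finset.card_image_of_injective _ (hf.injective.prodMap hf.injective)]
    congr 1
    refine Finset.filter_congr fun x _ => ?_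
    rw [hfpolar, map_add]
    rfl
  have htri : IsSumFreeTriple (A.image f) (B.image f) (C.image f) := by
    simpa using h.image hf.injective (show (0 : V4) + 0 + 0 = 0 by simp)
  have hne : ∀ w ∈ paraboloid, ((-w, 2) : V4) ∈ quadric ∧ ((-w, 2) : V4) ≠ vertex ∧
      ((-w, 2) : V4) ≠ apex ∧ ((-w, 2) : V4) ≠ -apex := by
    decide +kernel
  have hne' : ∀ w ∈ paraboloid, ((w, 1) : V4) ∈ quadric ∧ (w ≠ 0 → ((w, 1) : V4) ≠ vertex) ∧
      ((w, 1) : V4) ≠ apex ∧ ((w, 1) : V4) ≠ -apex := by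
    decide +kernel
  have hA2 : ∀ w ∈ paraboloid, (-w, 2) ∈ A.image f := by
    intro w hw
    obtain ⟨h1, h2, h3, h4⟩ := hne w hw
    refine hmem _ h1 (Or.inl ?_)
    rcases hfp with hfp | hfp | hfp <;> rw [hfp] <;> assumption
  rw [hcard]
  rcases hM with ⟨hA', hM⟩ | ⟨hA', hM⟩
  · refine card_filter_add_snd_le (hBf.isSumFreeCap hB) (hCf.isSumFreeCap hC) htri hA2
      (fun X Y hX hY hXY => ?_) (by rwa [hBf.card_eq, hCf.card_eq])
    refine (hXY.mono fun w hw => ?_).card_le_paraboloidBound hX hY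
    exact mem_slice.2 (hmem _ (hne' w hw).1 (Or.inr hA'))
  · refine card_filter_add_snd_le (hBf.isSumFreeCap hB) (hCf.isSumFreeCap hC) htri hA2
      (fun X Y hX hY hXY => ?_) (by rwa [hBf.card_eq, hCf.card_eq])
    refine (hXY.mono fun w hw => ?_).card_le_puncturedParaboloidBound hX hY
    obtain ⟨hw0, hw⟩ := Finset.mem_erase.1 hw
    obtain ⟨h1, h2, h3, h4⟩ := hne' w hw
    refine mem_slice.2 (hmem _ h1 (Or.inl ?_))
    rcases hfp with hfp | hfp | hfp <;> rw [hfp]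
    · exact h2 hw0
    · exact h3
    · exact h4

theorem eight_mul_card_mul_card_le {A B C : Finset V4} (h : IsSumFreeTriple A B C)
    (hA : A ⊆ quadric) {M : ℕ}
    (hM : ∀ d ∈ quadric, ((B ×ˢ C).filter fun x => polarForm d (x.1 + x.2) = 0).card ≤ M) :
    8 * (B.card * C.card) ≤ 20 * M + 6 * ((20 - A.card) * C.card) := by
  have hneg : ∀ w ∈ quadric, -w ∈ quadric := by decide +kernel
  have hbad : ((B ×ˢ C).filter fun x => x.1 + x.2 ∈ quadric).card ≤
      (20 - A.card) * C.card := by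
    rw [← card_quadric, ← Finset.card_sdiff_of_subset hA, ← Finset.card_product]
    refine Finset.card_le_card_of_injOn (fun x => (-(x.1 + x.2), x.2)) ?_ ?_
    · rintro ⟨b, c⟩ hx
      simp only [Finset.coe_filter, Finset.mem_product, Set.mem_ofPred_eq] at hx
      obtain ⟨⟨hb, hc⟩, hx⟩ := hx
      refine Finset.mem_coe.2 (Finset.mem_product.2 ⟨Finset.mem_sdiff.2 ⟨hneg _ hx, ?_⟩, hc⟩)
      exact fun ha => h _ ha b hb c hc (by rw [add_assoc, neg_add_cancel])
    · rintro ⟨b, c⟩ - ⟨b', c'⟩ - hx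
      obtain ⟨h1, rfl⟩ := Prod.mk.inj hx
      exact Prod.ext (add_right_cancel (neg_injective h1)) rfl
  have hcount : ∑ d ∈ quadric, ((B ×ˢ C).filter fun x => polarForm d (x.1 + x.2) = 0).card =
      ∑ x ∈ B ×ˢ C, (quadric.filter fun d => polarForm d (x.1 + x.2) = 0).card := by
    simp only [Finset.card_filter]
    exact Finset.sum_comm
  have hle := Finset.sum_le_card_nsmul _ _ M hM
  rw [hcount, card_quadric, smul_eq_mul] at hle
  have hge := Finset.card_nsmul_le_sum (B ×ˢ C) _ 8
    fun x _ => card_filter_polarForm_ge (x.1 + x.2)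
  rw [Finset.sum_add_distrib, Finset.card_product, smul_eq_mul, ← Finset.sum_filter,
    Finset.sum_const, smul_eq_mul] at hge
  omega

end DoubleCounting

/-- There are no caps with 46 points in dimension five. -/
theorem IsSumFreeCap.card_ne_forty_six {S : Finset V5} (hS : IsSumFreeCap S) : S.card ≠ 46 := by
  intro hcard
  obtain ⟨T, -, hT, hsizes⟩ := hS.exists_slice_sizes (fun _ h => h.card_le_twenty) hcard 2 19
    (by rw [card_V4]; norm_num)
    (p := fun a b c => (a == 6 && b == 20 && c == 20 || a == 7 && b == 20 && c == 19) ||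
      (a == 8 && b == 20 && c == 18 || a == 8 && b == 19 && c == 19)) (by decide +kernel)
  simp only [Bool.or_eq_true, Bool.and_eq_true, beq_iff_eq] at hsizes
  have htri := hT.isSumFreeTriple_slice (i := 1) (j := 2) (k := 0) (by decide) (by decide)
    (by decide)
  obtain ⟨A, hTA, hA⟩ :=
    (hT.isSumFreeCap_slice 1).exists_isAffineImage_subset_quadric (by omega)
  obtain ⟨B, C, hTB, hTC, hABC⟩ := htri.exists_image hTA
  have hB := hTB.isSumFreeCap (hT.isSumFreeCap_slice 2)
  have hC := hTC.isSumFreeCap (hT.isSumFreeCap_slice 0)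
  rw [← hTA.card_eq, ← hTB.card_eq, ← hTC.card_eq] at hsizes
  have key : ∀ M, (A.card = 20 ∧ SliceProductsBounded paraboloidBound B.card C.card M ∨
      A.card = 19 ∧ SliceProductsBounded puncturedParaboloidBound B.card C.card M) →
      8 * (B.card * C.card) ≤ 20 * M + 6 * ((20 - A.card) * C.card) := fun M hM =>
    eight_mul_card_mul_card_le hABC hA fun d hd => card_filter_polarForm_le hB hC hABC hA hd hM
  rcases hsizes with (⟨⟨c, a⟩, b⟩ | ⟨⟨c, a⟩, b⟩) | ⟨⟨c, a⟩, b⟩ | ⟨⟨c, a⟩, b⟩ <;> rw [a, b, c] at key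
  · exact absurd (key 44 (Or.inl ⟨rfl, by decide +kernel⟩)) (by decide)
  · exact absurd (key 51 (Or.inl ⟨rfl, by decide +kernel⟩)) (by decide)
  · exact absurd (key 54 (Or.inl ⟨rfl, by decide +kernel⟩)) (by decide)
  · exact absurd (key 56 (Or.inr ⟨rfl, by decide +kernel⟩)) (by decide)

/-- If a cap contains a set in one hyperplane and its translate in another parallel hyperplane,
then the set and a point of the third parallel hyperplane form a cap inside a hyperplane. -/
theorem IsSumFreeCap.insert_image_sub {V : Type*} [AddCommGroup V] [Module (ZMod 3) V]
    [DecidableEq V] {S : Finset V} (hS : IsSumFreeCap S) (ℓ : V →ₗ[ZMod 3] ZMod 3) {u p : V}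
    (hp : p ∈ S) (hℓp : ℓ p = 0) (h1 : ∀ x ∈ S, ℓ x = 1 → x + u ∈ S)
    (h2 : ∀ x ∈ S, ℓ x = 1 → ℓ (x + u) = 2) :
    IsSumFreeCap (insert p ((S.filter fun x => ℓ x = 1).image fun x => x + -u)) ∧
      p ∉ (S.filter fun x => ℓ x = 1).image fun x => x + -u := by
  have h01 : (0 : ZMod 3) ≠ 1 := by decide
  have h02 : (0 : ZMod 3) ≠ 2 := by decide
  have h12 : (1 : ZMod 3) ≠ 2 := by decide
  have hu := add_add_self_eq_zero u
  have hsum : ∀ x ∈ S, ℓ x = 1 → ∀ y ∈ S, ℓ y = 1 → p + x + (y + u) ≠ 0 := by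
    intro x hx hx1 y hy hy1
    refine hS p hp x hx _ (h1 y hy hy1) ?_ ?_ ?_
    · rintro rfl
      exact h01 (hℓp.symm.trans hx1)
    · intro h
      exact h02 (hℓp.symm.trans ((congrArg ℓ h).trans (h2 y hy hy1)))
    · intro h
      exact h12 (hx1.symm.trans ((congrArg ℓ h).trans (h2 y hy hy1)))
  have hpair : ∀ x ∈ S, ℓ x = 1 → ∀ y ∈ S, ℓ y = 1 → p + (x + -u) + (y + -u) ≠ 0 := by
    intro x hx hx1 y hy hy1 h
    refine hsum x hx hx1 y hy hy1 ?_
    rw [← h, ← sub_eq_zero, ← hu]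
    abel
  have himage : IsSumFreeCap ((S.filter fun x => ℓ x = 1).image fun x => x + -u) :=
    (IsAffineImage.translate _ (-u)).isSumFreeCap (hS.subset (Finset.filter_subset _ _))
  have hpne : ∀ x ∈ S, ℓ x = 1 → p ≠ x + -u := by
    intro x hx hx1 h
    refine hsum x hx hx1 x hx hx1 ?_
    rw [h, ← add_add_self_eq_zero x]
    abel
  simp only [Finset.mem_image, Finset.mem_filter]
  refine ⟨?_, fun ⟨x, ⟨hx, hx1⟩, h⟩ => hpne x hx hx1 h.symm⟩
  have hmem : ∀ a ∈ (S.filter fun x => ℓ x = 1).image fun x => x + -u,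
      ∃ x ∈ S, ℓ x = 1 ∧ x + -u = a := by
    intro a ha
    obtain ⟨x, hx, rfl⟩ := Finset.mem_image.1 ha
    exact ⟨x, (Finset.mem_filter.1 hx).1, (Finset.mem_filter.1 hx).2, rfl⟩
  have hpair' : ∀ a ∈ (S.filter fun x => ℓ x = 1).image fun x => x + -u,
      ∀ b ∈ (S.filter fun x => ℓ x = 1).image fun x => x + -u, p + a + b ≠ 0 := by
    intro a ha b hb
    obtain ⟨x, hx, hx1, rfl⟩ := hmem a ha
    obtain ⟨y, hy, hy1, rfl⟩ := hmem b hb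
    exact hpair x hx hx1 y hy hy1
  intro a ha b hb c hc hab hac hbc h
  rw [Finset.mem_insert] at ha hb hc
  rcases ha with rfl | ha
  · rcases hb with rfl | hb
    · exact hab rfl
    rcases hc with rfl | hc
    · exact hac rfl
    exact hpair' b hb c hc h
  rcases hb with rfl | hb
  · rcases hc with rfl | hc
    · exact hbc rfl
    exact hpair' a ha c hc (by rw [← h]; abel)
  rcases hc with rfl | hc
  · exact hpair' a ha b hb (by rw [← h]; abel)
  exact himage a ha b hb c hc hab hac hbc h

theorem exists_injective_ker (ℓ : (Fin 6 → ZMod 3) →ₗ[ZMod 3] ZMod 3) (hℓ : ℓ ≠ 0) :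
    ∃ f : ℓ.ker →+ V5, Function.Injective f := by
  have : Fact (Nat.Prime 3) := ⟨by norm_num⟩
  have hrank : Module.finrank (ZMod 3) ℓ.ker = Module.finrank (ZMod 3) V5 := by
    have h := Module.Dual.finrank_ker_add_one_of_ne_zero hℓ
    rw [Module.finrank_fin_fun] at h
    simp only [Module.finrank_prod, Module.finrank_self]
    omega
  let φ := LinearEquiv.ofFinrankEq _ _ hrank
  exact ⟨φ.toLinearMap.toAddMonoidHom, φ.injective⟩

/-- If two parallel hyperplane slices of a 6-dimensional cap are 45-caps that are
translations of each other, then the middle slice is empty. -/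
theorem middle_slice_empty_of_translation (S : Finset (Fin 6 → ZMod 3)) (hS : IsCap S)
    (ℓ : (Fin 6 → ZMod 3) →ₗ[ZMod 3] ZMod 3) (hℓ : ℓ ≠ 0)
    (h1 : (S.filter fun x => ℓ x = 1).card = 45)
    (h2 : (S.filter fun x => ℓ x = 2).card = 45)
    (htrans : ∃ u : Fin 6 → ZMod 3, ℓ u = 1 ∧
      (S.filter fun x => ℓ x = 2) = (S.filter fun x => ℓ x = 1).image (fun x => x + u)) :
    (S.filter fun x => ℓ x = 0) = ∅ := by
  obtain ⟨u, hu, htrans⟩ := htrans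
  refine Finset.filter_eq_empty_iff.2 fun p hp hp0 => ?_
  have hshift : ∀ x ∈ S, ℓ x = 1 → x + u ∈ S ∧ ℓ (x + u) = 2 := by
    intro x hx hx1
    have h : x + u ∈ S.filter fun x => ℓ x = 2 := by
      rw [htrans]
      exact Finset.mem_image_of_mem (· + u) (Finset.mem_filter.2 ⟨hx, hx1⟩)
    exact Finset.mem_filter.1 h
  obtain ⟨hcap, hnotMem⟩ := IsSumFreeCap.insert_image_sub (S := S) hS ℓ hp hp0
    (fun x hx hx1 => (hshift x hx hx1).1) fun x hx hx1 => (hshift x hx hx1).2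
  obtain ⟨f, hf⟩ := exists_injective_ker ℓ hℓ
  classical
  set T := insert p ((S.filter fun x => ℓ x = 1).image fun x => x + -u) with hT
  have hcard : T.card = 46 := by
    rw [hT, Finset.card_insert_of_notMem hnotMem,
      Finset.card_image_of_injective _ (add_left_injective (-u)), h1]
  have hker : ∀ x ∈ T, x ∈ ℓ.ker := by
    intro x hx
    rw [LinearMap.mem_ker]
    rcases Finset.mem_insert.1 hx with rfl | hx
    · exact hp0
    · obtain ⟨y, hy, rfl⟩ := Finset.mem_image.1 hx
      rw [map_add, map_neg, hu, (Finset.mem_filter.1 hy).2, add_neg_cancel]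
  have hcapKer : IsSumFreeCap (T.subtype (· ∈ ℓ.ker)) := by
    intro a ha b hb c hc hab hac hbc h
    rw [Finset.mem_subtype] at ha hb hc
    exact hcap a ha b hb c hc (fun h => hab (Subtype.ext h)) (fun h => hac (Subtype.ext h))
      (fun h => hbc (Subtype.ext h)) (congrArg Subtype.val h)
  have himage := IsAffineImage.of_hom f hf (T.subtype (· ∈ ℓ.ker))
  refine (himage.isSumFreeCap hcapKer).card_ne_forty_six ?_
  rw [himage.card_eq, Finset.card_subtype, Finset.filter_true_of_mem hker, hcard]
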